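/- arXiv:1102.2660 — 3 statements merged into one kernel-verified Lean document; each statement's English description precedes it below -/
import Mathlib

section
/- Let p be a prime and let G be a finite p-group acting continuously on a contractible topological manifold M. Then the fixed-point set M^G = {x ∈ M | g·x = x for all g ∈ G} is nonempty and path-connected (in the subspace topology). -/
/-- A topological manifold: a second-countable Hausdorff space in which every
point has an open neighborhood homeomorphic to an open subset of `ℝⁿ` for some `n`. -/
def IsTopologicalManifold (M : Type) [TopologicalSpace M] : Prop :=
  SecondCountableTopology M ∧ T2Space M ∧
    ∀ x : M, ∃ (n : ℕ) (U : Set M) (V : Set (Fin n → ℝ)),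
      IsOpen U ∧ x ∈ U ∧ IsOpen V ∧ Nonempty (U ≃ₜ V)

section FixedPointTheory

open Set Filter Topology Metric

namespace TupleChain

variable {R : Type} [CommRing R] {α β γ : Type}

/-- Prepending a vertex to every tuple of a chain. -/
noncomputable def cone (a : α) : (List α →₀ R) →ₗ[R] (List α →₀ R) :=
  Finsupp.lmapDomain R R (List.cons a)

@[simp]
lemma cone_single (a : α) (l : List α) (r : R) :
    cone a (Finsupp.single l r) = Finsupp.single (a :: l) r := by
  simp [cone]

/-- The boundary of a single tuple. -/
noncomputable def bdTuple (R : Type) [CommRing R] {α : Type} : List α → (List α →₀ R)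
  | [] => 0
  | a :: l => Finsupp.single l 1 - cone a (bdTuple R l)

/-- The boundary operator of the augmented complex of ordered tuples. -/
noncomputable def bd : (List α →₀ R) →ₗ[R] (List α →₀ R) :=
  Finsupp.linearCombination R (bdTuple R)

lemma bd_single (l : List α) : bd (Finsupp.single l (1 : R)) = bdTuple R l := by
  simp [bd]

@[simp]
lemma bd_nil : bd (Finsupp.single ([] : List α) (1 : R)) = 0 := by
  rw [bd_single]; rfl

lemma linearMap_ext {N : Type} [AddCommGroup N] [Module R N] {f g : (List α →₀ R) →ₗ[R] N}
    (h : ∀ l, f (Finsupp.single l 1) = g (Finsupp.single l 1)) : f = g := by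
  refine Finsupp.lhom_ext' fun l => LinearMap.ext_ring ?_
  simpa using h l

lemma bd_cone (a : α) (z : List α →₀ R) : bd (cone a z) = z - cone a (bd z) := by
  have : (bd ∘ₗ cone a : (List α →₀ R) →ₗ[R] _) = LinearMap.id - cone a ∘ₗ bd := by
    refine linearMap_ext fun l => ?_
    simp [bd_single, bdTuple]
  exact LinearMap.congr_fun this z

lemma bd_cons (a : α) (l : List α) :
    bd (Finsupp.single (a :: l) (1 : R)) =
      Finsupp.single l 1 - cone a (bd (Finsupp.single l 1)) := by
  rw [← cone_single, bd_cone]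

lemma bd_bd (z : List α →₀ R) : bd (bd z) = 0 := by
  have : (bd ∘ₗ bd : (List α →₀ R) →ₗ[R] _) = 0 := by
    refine linearMap_ext fun l => ?_
    induction l with
    | nil => simp
    | cons a l ih =>
      simp only [LinearMap.comp_apply, LinearMap.zero_apply] at ih ⊢
      rw [bd_cons, map_sub, bd_cone, ih]
      simp
  exact LinearMap.congr_fun this z

/-- The chain map induced by a map of vertices. -/
noncomputable def push (f : α → β) : (List α →₀ R) →ₗ[R] (List β →₀ R) :=
  Finsupp.lmapDomain R R (List.map f)

@[simp]
lemma push_single (f : α → β) (l : List α) (r : R) :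
    push f (Finsupp.single l r) = Finsupp.single (l.map f) r := by
  simp [push]

lemma push_cone (f : α → β) (a : α) (z : List α →₀ R) :
    push f (cone a z) = cone (f a) (push f z) := by
  have : (push f ∘ₗ cone a : (List α →₀ R) →ₗ[R] _) = cone (f a) ∘ₗ push f :=
    linearMap_ext fun l => by simp
  exact LinearMap.congr_fun this z

lemma bd_push (f : α → β) (z : List α →₀ R) : bd (push f z) = push f (bd z) := by
  have : (bd ∘ₗ push f : (List α →₀ R) →ₗ[R] _) = push f ∘ₗ bd := by
    refine linearMap_ext fun l => ?_
    induction l with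
    | nil => simp
    | cons a l ih =>
      simp only [LinearMap.comp_apply, push_single, List.map_cons] at ih ⊢
      rw [bd_cons, bd_cons, map_sub, push_cone, ih]
      simp
  exact LinearMap.congr_fun this z

/-- A linear map sends chains supported on `S` into a submodule as soon as it does so for the
tuples in `S`. -/
lemma map_mem_of_supported {N : Type} [AddCommGroup N] [Module R N]
    {S : Set (List α)} {P : Submodule R N} (f : (List α →₀ R) →ₗ[R] N)
    (h : ∀ l ∈ S, f (Finsupp.single l 1) ∈ P) {z : List α →₀ R}
    (hz : z ∈ Finsupp.supported R R S) : f z ∈ P := by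
  rw [Finsupp.supported_eq_span_single] at hz
  have : Submodule.span R ((fun i => Finsupp.single i (1 : R)) '' S) ≤ P.comap f := by
    rw [Submodule.span_le]
    rintro _ ⟨l, hl, rfl⟩
    exact h l hl
  exact this hz

lemma map_eq_of_supported {N : Type} [AddCommGroup N] [Module R N]
    {S : Set (List α)} (f g : (List α →₀ R) →ₗ[R] N)
    (h : ∀ l ∈ S, f (Finsupp.single l 1) = g (Finsupp.single l 1)) {z : List α →₀ R}
    (hz : z ∈ Finsupp.supported R R S) : f z = g z := by
  have := map_mem_of_supported (P := ⊥) (f - g) (fun l hl => by simp [h l hl]) hz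
  simpa [sub_eq_zero] using this

lemma cone_mem {S T : Set (List α)} {a : α} (h : ∀ l ∈ S, a :: l ∈ T) {z : List α →₀ R}
    (hz : z ∈ Finsupp.supported R R S) : cone a z ∈ Finsupp.supported R R T :=
  map_mem_of_supported _ (fun l hl => by
    rw [cone_single]; exact Finsupp.single_mem_supported R _ (h l hl)) hz

lemma push_mem {S : Set (List α)} {T : Set (List β)} {f : α → β} (h : ∀ l ∈ S, l.map f ∈ T)
    {z : List α →₀ R} (hz : z ∈ Finsupp.supported R R S) :
    push f z ∈ Finsupp.supported R R T :=
  map_mem_of_supported _ (fun l hl => by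
    rw [push_single]; exact Finsupp.single_mem_supported R _ (h l hl)) hz

/-- The boundary of a tuple is supported on its faces. -/
lemma bd_single_mem (l : List α) :
    bd (Finsupp.single l (1 : R)) ∈
      Finsupp.supported R R {m : List α | m.Sublist l ∧ m.length + 1 = l.length} := by
  induction l with
  | nil => simp
  | cons a l ih =>
    rw [bd_cons]
    refine Submodule.sub_mem _ (Finsupp.single_mem_supported R _ ⟨by simp, by simp⟩)
      (cone_mem ?_ ih)
    rintro m ⟨h1, h2⟩
    exact ⟨h1.cons_cons a, by simpa using h2⟩

lemma bd_mem {S T : Set (List α)}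
    (h : ∀ l ∈ S, ∀ m : List α, m.Sublist l → m.length + 1 = l.length → m ∈ T)
    {z : List α →₀ R} (hz : z ∈ Finsupp.supported R R S) : bd z ∈ Finsupp.supported R R T :=
  map_mem_of_supported _ (fun l hl =>
    Finsupp.supported_mono (fun m hm => h l hl m hm.1 hm.2) (bd_single_mem l)) hz

/-- The operator obtained by iterated coning of `A - H ∘ bd` from the image of the first vertex. -/
noncomputable def homotopyOp (f : α → β) (A : ℕ → (List α →₀ R) →ₗ[R] (List β →₀ R)) :
    ℕ → (List α →₀ R) →ₗ[R] (List β →₀ R)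
  | 0 => 0
  | n + 1 => Finsupp.linearCombination R fun l => match l with
    | [] => 0
    | a :: l' => cone (f a) (A (n + 1) (Finsupp.single (a :: l') 1) -
        homotopyOp f A n (bd (Finsupp.single (a :: l') 1)))

lemma homotopyOp_succ_cons (f : α → β) (A : ℕ → (List α →₀ R) →ₗ[R] (List β →₀ R)) (n : ℕ)
    (a : α) (l : List α) :
    homotopyOp f A (n + 1) (Finsupp.single (a :: l) 1) =
      cone (f a) (A (n + 1) (Finsupp.single (a :: l) 1) -
        homotopyOp f A n (bd (Finsupp.single (a :: l) 1))) := by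
  simp [homotopyOp]

lemma bd_homotopyOp (f : α → β) (A : ℕ → (List α →₀ R) →ₗ[R] (List β →₀ R))
    (S : ℕ → Set (List α)) (hlen : ∀ n, ∀ l ∈ S n, l.length = n)
    (hface : ∀ n, ∀ l ∈ S (n + 1), ∀ m : List α, m.Sublist l → m.length + 1 = l.length → m ∈ S n)
    (h0 : ∀ l ∈ S 0, A 0 (Finsupp.single l 1) = 0)
    (hA : ∀ n, ∀ l ∈ S (n + 1),
      bd (A (n + 1) (Finsupp.single l 1)) = A n (bd (Finsupp.single l 1)))
    (n : ℕ) {z : List α →₀ R} (hz : z ∈ Finsupp.supported R R (S (n + 1))) :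
    bd (homotopyOp f A (n + 1) z) + homotopyOp f A n (bd z) = A (n + 1) z := by
  have key : ∀ n, ∀ l ∈ S (n + 1), bd (homotopyOp f A (n + 1) (Finsupp.single l 1)) =
      A (n + 1) (Finsupp.single l 1) - homotopyOp f A n (bd (Finsupp.single l 1)) := by
    intro n
    induction n with
    | zero =>
      intro l hl
      have hb : A 0 (bd (Finsupp.single l 1)) = 0 := by
        simpa using map_eq_of_supported (A 0) 0 (fun l hl => by simpa using h0 l hl)
          (bd_mem (hface 0) (Finsupp.single_mem_supported R (1 : R) hl))
      cases l with
      | nil => simpa using hlen _ _ hl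
      | cons a l =>
        rw [homotopyOp_succ_cons, bd_cone, map_sub, hA _ _ hl, hb]
        simp [homotopyOp]
    | succ n ih =>
      intro l hl
      have hb := map_eq_of_supported (bd ∘ₗ homotopyOp f A (n + 1))
        (A (n + 1) - homotopyOp f A n ∘ₗ bd) (fun l hl => ih l hl)
        (bd_mem (hface (n + 1)) (Finsupp.single_mem_supported R (1 : R) hl))
      simp only [LinearMap.comp_apply, LinearMap.sub_apply, bd_bd, map_zero, sub_zero] at hb
      cases l with
      | nil => simpa using hlen _ _ hl
      | cons a l =>
        rw [homotopyOp_succ_cons, bd_cone, map_sub, hA _ _ hl, hb]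
        simp
  refine map_eq_of_supported (bd ∘ₗ homotopyOp f A (n + 1) + homotopyOp f A n ∘ₗ bd) (A (n + 1))
    (fun l hl => ?_) hz
  simp [key n l hl]

/-- Tuples of length `n` all of whose entries are related to an entry of `l`. -/
def carrier (E : α → β → Prop) (l : List α) (n : ℕ) : Set (List β) :=
  {m | m.length = n ∧ ∀ y ∈ m, ∃ a ∈ l, E a y}

lemma homotopyOp_mem (f : α → β) (A : ℕ → (List α →₀ R) →ₗ[R] (List β →₀ R))
    (E : α → β → Prop) (hE : ∀ a, E a (f a)) (S : ℕ → Set (List α))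
    (hlen : ∀ n, ∀ l ∈ S n, l.length = n)
    (hface : ∀ n, ∀ l ∈ S (n + 1), ∀ m : List α, m.Sublist l → m.length + 1 = l.length → m ∈ S n)
    (hA : ∀ n, ∀ l ∈ S n, A n (Finsupp.single l 1) ∈ Finsupp.supported R R (carrier E l n))
    (n : ℕ) : ∀ l ∈ S n,
      homotopyOp f A n (Finsupp.single l 1) ∈ Finsupp.supported R R (carrier E l (n + 1)) := by
  induction n with
  | zero => intro l _; simp [homotopyOp]
  | succ n ih =>
    intro l hl
    cases l with
    | nil => simpa using hlen _ _ hl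
    | cons a l =>
      rw [homotopyOp_succ_cons]
      refine cone_mem (S := carrier E (a :: l) (n + 1)) ?_ (Submodule.sub_mem _ (hA _ _ hl) ?_)
      · rintro m ⟨h1, h2⟩
        refine ⟨by simp [h1], fun y hy => ?_⟩
        rcases List.mem_cons.1 hy with rfl | hy
        · exact ⟨a, by simp, hE a⟩
        · exact h2 y hy
      · refine map_mem_of_supported _ ?_ (bd_single_mem (R := R) (a :: l))
        rintro m ⟨hm1, hm2⟩
        refine Finsupp.supported_mono ?_ (ih m (hface n _ hl m hm1 hm2))
        rintro k ⟨h1, h2⟩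
        refine ⟨h1, fun y hy => ?_⟩
        obtain ⟨b, hb, hy⟩ := h2 y hy
        exact ⟨b, hm1.subset hb, hy⟩

lemma push_homotopyOp (g : α → α) (f : α → α) (hf : ∀ a, f (g a) = g (f a))
    (A : ℕ → (List α →₀ R) →ₗ[R] (List α →₀ R)) (hA : ∀ n z, A n (push g z) = push g (A n z))
    (n : ℕ) (z : List α →₀ R) :
    homotopyOp f A n (push g z) = push g (homotopyOp f A n z) := by
  induction n generalizing z with
  | zero => simp [homotopyOp]
  | succ n ih =>
    have : homotopyOp f A (n + 1) ∘ₗ push g = push g ∘ₗ homotopyOp f A (n + 1) := by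
      refine linearMap_ext fun l => ?_
      cases l with
      | nil => simp [homotopyOp]
      | cons a l =>
        simp only [LinearMap.comp_apply, push_single, List.map_cons]
        rw [homotopyOp_succ_cons, homotopyOp_succ_cons, push_cone, map_sub (push (R := R) g),
          ← hA, ← ih, ← bd_push]
        simp [hf]
    exact LinearMap.congr_fun this z

/-! ### Ordering the vertices of small tuples -/

/-- The tuples of length `n` in which distinct entries have distinct colours. -/
def colorInj {O : Type} (col : α → O) (n : ℕ) : Set (List α) :=
  {l | l.length = n ∧ ∀ x ∈ l, ∀ y ∈ l, col x = col y → x = y}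

lemma colorInj_face {O : Type} (col : α → O) (n : ℕ) :
    ∀ l ∈ colorInj col (n + 1), ∀ m : List α, m.Sublist l → m.length + 1 = l.length →
      m ∈ colorInj col n := by
  rintro l ⟨h1, h2⟩ m hm hl
  exact ⟨by omega, fun x hx y hy => h2 x (hm.subset hx) y (hm.subset hy)⟩

section Order

variable {O : Type} [LinearOrder O] (col : α → O)

/-- The first entry of minimal colour of `a :: l`. -/
def minCol : α → List α → α
  | a, [] => a
  | a, b :: l => if col b < col a then minCol b l else minCol a l

lemma minCol_mem (a : α) (l : List α) : minCol col a l ∈ a :: l := by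
  induction l generalizing a with
  | nil => simp [minCol]
  | cons b l ih =>
    rw [minCol]
    split_ifs
    · exact List.mem_cons_of_mem _ (ih b)
    · rcases List.mem_cons.1 (ih a) with h | h
      · rw [h]; simp
      · simp [h]

lemma minCol_le (a : α) (l : List α) : ∀ x ∈ a :: l, col (minCol col a l) ≤ col x := by
  induction l generalizing a with
  | nil => simp [minCol]
  | cons b l ih =>
    intro x hx
    rw [minCol]
    split_ifs with h
    · rcases List.mem_cons.1 hx with rfl | hx
      · exact (ih b b (by simp)).trans h.le
      · exact ih b x hx
    · rcases List.mem_cons.1 hx with rfl | hx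
      · exact ih x x (by simp)
      · rcases List.mem_cons.1 hx with rfl | hx
        · exact (ih a a (by simp)).trans (not_lt.1 h)
        · exact ih a x (by simp [hx])

lemma minCol_map (g : α → α) (hg : ∀ a, col (g a) = col a) (a : α) (l : List α) :
    minCol col (g a) (l.map g) = g (minCol col a l) := by
  induction l generalizing a with
  | nil => simp [minCol]
  | cons b l ih =>
    simp only [List.map_cons, minCol, hg]
    split_ifs <;> exact ih _

open Classical in
/-- Coning off with a vertex, omitting the tuples that already start with that vertex. -/
noncomputable def coneNe (c : α) : (List α →₀ R) →ₗ[R] (List α →₀ R) :=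
  Finsupp.linearCombination R fun m =>
    if m.head? = some c then 0 else Finsupp.single (c :: m) 1

lemma coneNe_single_of_eq {c : α} {m : List α} (h : m.head? = some c) :
    coneNe c (Finsupp.single m (1 : R)) = 0 := by
  simp [coneNe, h]

lemma coneNe_single_of_ne {c : α} {m : List α} (h : m.head? ≠ some c) :
    coneNe c (Finsupp.single m (1 : R)) = Finsupp.single (c :: m) 1 := by
  simp [coneNe, h]

lemma coneNe_cone (c : α) (z : List α →₀ R) : coneNe c (cone c z) = 0 := by
  have : (coneNe c ∘ₗ cone c : (List α →₀ R) →ₗ[R] _) = 0 :=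
    linearMap_ext fun l => by
      rw [LinearMap.comp_apply, cone_single, coneNe_single_of_eq (by simp)]; rfl
  exact LinearMap.congr_fun this z

lemma push_coneNe (g : α → α) (hg : Function.Injective g) (c : α) (z : List α →₀ R) :
    push g (coneNe c z) = coneNe (g c) (push g z) := by
  have : (push g ∘ₗ coneNe c : (List α →₀ R) →ₗ[R] _) = coneNe (g c) ∘ₗ push g := by
    refine linearMap_ext fun l => ?_
    by_cases h : l.head? = some c
    · simp [coneNe_single_of_eq, h]
    · rw [LinearMap.comp_apply, LinearMap.comp_apply, coneNe_single_of_ne h, push_single,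
        push_single, coneNe_single_of_ne]
      · simp
      · intro h'
        apply h
        rw [List.head?_map, Option.map_eq_some_iff] at h'
        obtain ⟨a, ha, hac⟩ := h'
        rw [ha, hg hac]
  exact LinearMap.congr_fun this z

/-- The tuples with strictly increasing colours. -/
def increasing : Set (List α) := {m | m.Pairwise fun x y => col x < col y}

lemma bd_coneNe (c : α) {z : List α →₀ R} (hz : z ∈ Finsupp.supported R R
      {m | m ∈ increasing col ∧ ∀ x ∈ m, col c ≤ col x ∧ (col x = col c → x = c)}) :
    bd (coneNe c z) = z - coneNe c (bd z) := by
  refine map_eq_of_supported (bd ∘ₗ coneNe c) (LinearMap.id - coneNe c ∘ₗ bd) ?_ hz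
  rintro m ⟨hm, hmc⟩
  have hne : ∀ k : List α, (∀ x ∈ k, col c < col x) → k.head? ≠ some c := by
    intro k hk h
    exact lt_irrefl _ (hk c (List.mem_of_mem_head? (by simp [h])))
  have hcone : ∀ k : List α, (∀ x ∈ k, col c < col x) →
      coneNe c (bd (Finsupp.single k (1 : R))) = cone c (bd (Finsupp.single k 1)) := by
    intro k hk
    refine map_eq_of_supported _ _ ?_ (bd_single_mem k)
    rintro l ⟨hl, -⟩
    rw [coneNe_single_of_ne (hne l fun x hx => hk x (hl.subset hx)), cone_single]
  simp only [LinearMap.comp_apply, LinearMap.sub_apply, LinearMap.id_apply]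
  by_cases h : m.head? = some c
  · obtain ⟨k, rfl⟩ : ∃ k, m = c :: k := by
      cases m with
      | nil => simp at h
      | cons a k => exact ⟨k, by simpa using h⟩
    have hk : ∀ x ∈ k, col c < col x := (List.pairwise_cons.1 hm).1
    rw [coneNe_single_of_eq h, bd_cons, map_sub, coneNe_cone, coneNe_single_of_ne (hne k hk)]
    simp
  · have hk : ∀ x ∈ m, col c < col x := by
      cases m with
      | nil => simp
      | cons a k =>
        have ha : col c < col a := by
          refine lt_of_le_of_ne (hmc a (by simp)).1 fun h' => h ?_
          simp [(hmc a (by simp)).2 h'.symm]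
        intro x hx
        rcases List.mem_cons.1 hx with rfl | hx
        · exact ha
        · exact ha.trans ((List.pairwise_cons.1 hm).1 x hx)
    rw [coneNe_single_of_ne h, bd_cons, hcone m hk]

/-- The chain map that antisymmetrises a tuple and sorts it by colour. -/
noncomputable def sortOp : ℕ → (List α →₀ R) →ₗ[R] (List α →₀ R)
  | 0 => Finsupp.linearCombination R fun _ => Finsupp.single [] 1
  | n + 1 => Finsupp.linearCombination R fun l => match l with
    | [] => 0
    | a :: l' => coneNe (minCol col a l') (sortOp n (bd (Finsupp.single (a :: l') 1)))

lemma sortOp_zero (l : List α) :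
    sortOp col 0 (Finsupp.single l (1 : R)) = Finsupp.single [] 1 := by
  simp [sortOp]

lemma sortOp_succ_cons (n : ℕ) (a : α) (l : List α) :
    sortOp col (n + 1) (Finsupp.single (a :: l) (1 : R)) =
      coneNe (minCol col a l) (sortOp col n (bd (Finsupp.single (a :: l) 1))) := by
  simp [sortOp]

lemma push_sortOp (g : α → α) (hg : Function.Injective g) (hcol : ∀ a, col (g a) = col a)
    (n : ℕ) (z : List α →₀ R) : sortOp col n (push g z) = push g (sortOp col n z) := by
  induction n generalizing z with
  | zero =>
    have : (sortOp col 0 ∘ₗ push g : (List α →₀ R) →ₗ[R] _) = push g ∘ₗ sortOp col 0 :=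
      linearMap_ext fun l => by simp [sortOp_zero]
    exact LinearMap.congr_fun this z
  | succ n ih =>
    have : (sortOp col (n + 1) ∘ₗ push g : (List α →₀ R) →ₗ[R] _) =
        push g ∘ₗ sortOp col (n + 1) := by
      refine linearMap_ext fun l => ?_
      cases l with
      | nil => simp [sortOp]
      | cons a l =>
        simp only [LinearMap.comp_apply, push_single, List.map_cons]
        rw [sortOp_succ_cons, sortOp_succ_cons, push_coneNe g hg, minCol_map col g hcol, ← ih,
          ← bd_push]
        simp
    exact LinearMap.congr_fun this z

lemma sortOp_mem (n : ℕ) : ∀ l ∈ colorInj col n, sortOp col n (Finsupp.single l (1 : R)) ∈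
    Finsupp.supported R R {m | m ∈ increasing col ∧ m.length = n ∧ ∀ x ∈ m, x ∈ l} := by
  induction n with
  | zero =>
    intro l _
    rw [sortOp_zero]
    exact Finsupp.single_mem_supported R _ ⟨List.Pairwise.nil, by simp⟩
  | succ n ih =>
    intro l hl
    cases l with
    | nil => simpa using hl.1
    | cons a l =>
      rw [sortOp_succ_cons]
      have h1 : sortOp col n (bd (Finsupp.single (a :: l) (1 : R))) ∈ Finsupp.supported R R
          {m | m ∈ increasing col ∧ m.length = n ∧ ∀ x ∈ m, x ∈ a :: l} := by
        refine map_mem_of_supported _ ?_ (bd_single_mem (R := R) (a :: l))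
        rintro k ⟨hk1, hk2⟩
        refine Finsupp.supported_mono ?_ (ih k (colorInj_face col n _ hl k hk1 hk2))
        rintro m ⟨hm1, hm2, hm3⟩
        exact ⟨hm1, hm2, fun x hx => hk1.subset (hm3 x hx)⟩
      refine map_mem_of_supported _ ?_ h1
      rintro m ⟨hm1, hm2, hm3⟩
      by_cases h : m.head? = some (minCol col a l)
      · rw [coneNe_single_of_eq h]; exact Submodule.zero_mem _
      · rw [coneNe_single_of_ne h]
        refine Finsupp.single_mem_supported R _ ⟨?_, by simp [hm2], ?_⟩
        · refine List.pairwise_cons.2 ⟨?_, hm1⟩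
          cases m with
          | nil => simp
          | cons b k =>
            have hb : col (minCol col a l) < col b := by
              refine lt_of_le_of_ne (minCol_le col a l b (hm3 b (by simp))) fun h' => h ?_
              simp [hl.2 _ (minCol_mem col a l) b (hm3 b (by simp)) h']
            intro x hx
            rcases List.mem_cons.1 hx with rfl | hx
            · exact hb
            · exact hb.trans ((List.pairwise_cons.1 hm1).1 x hx)
        · intro x hx
          rcases List.mem_cons.1 hx with rfl | hx
          · exact minCol_mem col a l
          · exact hm3 x hx

lemma bd_sortOp (n : ℕ) : ∀ l ∈ colorInj col (n + 1),
    bd (sortOp col (n + 1) (Finsupp.single l (1 : R))) =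
      sortOp col n (bd (Finsupp.single l 1)) := by
  have key : ∀ n, ∀ l ∈ colorInj col (n + 1),
      bd (sortOp col n (bd (Finsupp.single l (1 : R)))) = 0 →
      bd (sortOp col (n + 1) (Finsupp.single l (1 : R))) =
        sortOp col n (bd (Finsupp.single l 1)) := by
    intro n l hl h0
    cases l with
    | nil => simpa using hl.1
    | cons a l =>
      rw [sortOp_succ_cons, bd_coneNe col, h0]
      · simp
      refine map_mem_of_supported _ ?_ (bd_single_mem (R := R) (a :: l))
      rintro k ⟨hk1, hk2⟩
      refine Finsupp.supported_mono ?_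
        (sortOp_mem col n k (colorInj_face col n _ hl k hk1 hk2))
      rintro m ⟨hm1, hm2, hm3⟩
      refine ⟨hm1, fun x hx => ⟨minCol_le col a l x (hk1.subset (hm3 x hx)), fun h => ?_⟩⟩
      exact hl.2 _ (hk1.subset (hm3 x hx)) _ (minCol_mem col a l) h
  induction n with
  | zero =>
    intro l hl
    refine key 0 l hl ?_
    have : (bd ∘ₗ sortOp col 0 : (List α →₀ R) →ₗ[R] _) = 0 :=
      linearMap_ext fun l => by simp [sortOp_zero]
    exact LinearMap.congr_fun this _
  | succ n ih =>
    intro l hl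
    refine key (n + 1) l hl ?_
    have := map_eq_of_supported (bd ∘ₗ sortOp col (n + 1)) (sortOp col n ∘ₗ bd)
      (fun l hl => ih l hl)
      (bd_mem (colorInj_face col (n + 1)) (Finsupp.single_mem_supported R (1 : R) hl))
    simpa [bd_bd] using this

end Order

section Cyclic

variable {R : Type} [CommRing R] {X : Type}

/-- The operator `1 - g` on the free module on a set with a self-map `g`. -/
noncomputable def diffOp (R : Type) [CommRing R] {X : Type} (f : X → X) : (X →₀ R) →ₗ[R] (X →₀ R) :=
  LinearMap.id - Finsupp.lmapDomain R R f

/-- The operator `1 + g + ⋯ + g ^ (p - 1)` on the free module on a set with a self-map `g`. -/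
noncomputable def normOp (R : Type) [CommRing R] {X : Type} (p : ℕ) (f : X → X) :
    (X →₀ R) →ₗ[R] (X →₀ R) :=
  ∑ i ∈ Finset.range p, Finsupp.lmapDomain R R f^[i]

lemma diffOp_apply (f : X → X) (z : X →₀ R) :
    diffOp R f z = z - Finsupp.mapDomain f z := rfl

lemma normOp_apply (p : ℕ) (f : X → X) (z : X →₀ R) :
    normOp R p f z = ∑ i ∈ Finset.range p, Finsupp.mapDomain f^[i] z := by
  simp [normOp]

lemma mapDomain_iterate_eq {p : ℕ} {f : X → X} {S : Set X} (hp : ∀ x ∈ S, f^[p] x = x)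
    {z : X →₀ R} (hz : z ∈ Finsupp.supported R R S) : Finsupp.mapDomain f^[p] z = z := by
  rw [Finsupp.mapDomain_congr (g := id), Finsupp.mapDomain_id]
  intro x hx
  exact hp x ((Finsupp.mem_supported R z).1 hz hx)

lemma normOp_diffOp {p : ℕ} {f : X → X} {S : Set X} (hp : ∀ x ∈ S, f^[p] x = x)
    {z : X →₀ R} (hz : z ∈ Finsupp.supported R R S) : normOp R p f (diffOp R f z) = 0 := by
  have h : ∀ i, Finsupp.mapDomain f^[i] (diffOp R f z) =
      Finsupp.mapDomain f^[i] z - Finsupp.mapDomain f^[i + 1] z := by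
    intro i
    have := map_sub (Finsupp.lmapDomain R R f^[i]) z (Finsupp.mapDomain f z)
    rw [Function.iterate_succ, Finsupp.mapDomain_comp]
    exact this
  simp only [normOp_apply, h]
  rw [Finset.sum_range_sub', mapDomain_iterate_eq hp hz]
  simp

lemma diffOp_normOp {p : ℕ} {f : X → X} {S : Set X} (hp : ∀ x ∈ S, f^[p] x = x)
    {z : X →₀ R} (hz : z ∈ Finsupp.supported R R S) : diffOp R f (normOp R p f z) = 0 := by
  have h : Finsupp.mapDomain f (normOp R p f z) =
      ∑ i ∈ Finset.range p, Finsupp.mapDomain f^[i + 1] z := by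
    rw [normOp_apply, ← Finsupp.lmapDomain_apply R R, map_sum]
    simp only [Finsupp.lmapDomain_apply, ← Finsupp.mapDomain_comp, Function.iterate_succ']
  rw [diffOp_apply, h, normOp_apply, ← Finset.sum_sub_distrib, Finset.sum_range_sub',
    mapDomain_iterate_eq hp hz]
  simp

lemma diffOp_apply_of_fixed {f : X → X} (hf : Function.Injective f) {x : X} (hx : f x = x)
    (z : X →₀ R) : diffOp R f z x = 0 := by
  have : Finsupp.mapDomain f z x = z x := by
    conv_lhs => rw [← hx]
    exact Finsupp.mapDomain_apply hf z x
  simp [diffOp_apply, this]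

lemma normOp_apply_of_fixed {p : ℕ} (hpR : (p : R) = 0) {f : X → X} (hf : Function.Injective f)
    {x : X} (hx : f x = x) (z : X →₀ R) : normOp R p f z x = 0 := by
  have : ∀ i, Finsupp.mapDomain f^[i] z x = z x := by
    intro i
    conv_lhs => rw [← Function.iterate_fixed hx i]
    exact Finsupp.mapDomain_apply (hf.iterate i) z x
  simp [normOp_apply, this, hpR]

lemma fixed_of_iterate {p : ℕ} (hp : p.Prime) {f : X → X} {x : X} (hx : f^[p] x = x) {i : ℕ}
    (hi0 : i ≠ 0) (hip : i < p) (hi : f^[i] x = x) : f x = x := by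
  have h1 : Function.minimalPeriod f x ∣ p := Function.IsPeriodicPt.minimalPeriod_dvd hx
  have h2 : Function.minimalPeriod f x ∣ i := Function.IsPeriodicPt.minimalPeriod_dvd hi
  have hc : Nat.Coprime i p := (Nat.coprime_of_lt_prime hi0 hip hp).symm
  have h3 : Function.minimalPeriod f x = 1 := Nat.eq_one_of_dvd_coprimes hc h2 h1
  exact Function.minimalPeriod_eq_one_iff_isFixedPt.1 h3

lemma support_erase_aux {z z' : X →₀ R} {l : X} (hl : l ∈ z.support) (h : z' l = 0)
    (h' : ∀ x, z x = 0 → z' x = 0) : z'.support.card < z.support.card := by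
  refine Finset.card_lt_card (Finset.ssubset_iff_of_subset ?_ |>.2 ⟨l, hl, by simp [h]⟩)
  intro x hx
  rw [Finsupp.mem_support_iff] at hx ⊢
  exact fun h0 => hx (h' x h0)

lemma exists_of_diffOp_eq_zero {p : ℕ} (hp : p.Prime) {f : X → X} (hf : Function.Injective f)
    {S : Set X} (hS : MapsTo f S S) (hfp : ∀ x ∈ S, f^[p] x = x) (z : X →₀ R)
    (hz : z ∈ Finsupp.supported R R S) (h0 : diffOp R f z = 0) :
    ∃ a ∈ Finsupp.supported R R S, ∃ w ∈ Finsupp.supported R R {x ∈ S | f x = x},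
      z = normOp R p f a + w := by
  induction hn : z.support.card using Nat.strong_induction_on generalizing z with
  | _ n ih =>
    by_cases hfix : ∀ x ∈ z.support, f x = x
    · exact ⟨0, Submodule.zero_mem _, z, (Finsupp.mem_supported R z).2 fun x hx =>
        ⟨(Finsupp.mem_supported R z).1 hz hx, hfix x hx⟩, by simp⟩
    push Not at hfix
    obtain ⟨l, hl, hfl⟩ := hfix
    have hlS : l ∈ S := (Finsupp.mem_supported R z).1 hz hl
    have hinv : ∀ i x, z (f^[i] x) = z x := by
      intro i x
      have h1 : Finsupp.mapDomain f z = z := by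
        rw [diffOp_apply, sub_eq_zero] at h0; exact h0.symm
      induction i with
      | zero => rfl
      | succ i ihi =>
        rw [Function.iterate_succ_apply']
        conv_lhs => rw [← h1]
        rw [Finsupp.mapDomain_apply hf, ihi]
    have hls : Finsupp.single l (1 : R) ∈ Finsupp.supported R R S :=
      Finsupp.single_mem_supported R _ hlS
    have hN : normOp R p f (Finsupp.single l (1 : R)) =
        ∑ i ∈ Finset.range p, Finsupp.single (f^[i] l) 1 := by
      simp [normOp_apply]
    have hNl : normOp R p f (Finsupp.single l (1 : R)) l = 1 := by
      rw [hN, Finsupp.finsetSum_apply, Finset.sum_eq_single 0]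
      · simp
      · intro i hi hi0
        refine Finsupp.single_eq_of_ne' ?_
        exact fun h => hfl (fixed_of_iterate hp (hfp l hlS) hi0 (Finset.mem_range.1 hi) h)
      · intro h; exact absurd (Finset.mem_range.2 hp.pos) h
    have hNS : normOp R p f (Finsupp.single l (1 : R)) ∈ Finsupp.supported R R S := by
      rw [hN]
      exact Submodule.sum_mem _ fun i _ => Finsupp.single_mem_supported R _ (hS.iterate i hlS)
    obtain ⟨a, ha, w, hw, h⟩ := ih _ (hn ▸ support_erase_aux (z' := z - z l • normOp R p f
      (Finsupp.single l (1 : R))) hl (by simp [hNl]) (by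
        intro x hx
        have : z l • normOp R p f (Finsupp.single l (1 : R)) x = 0 := by
          rw [hN, Finsupp.finsetSum_apply, Finset.smul_sum]
          refine Finset.sum_eq_zero fun i _ => ?_
          by_cases h : f^[i] l = x
          · rw [← hinv i l, h, hx]; simp
          · rw [Finsupp.single_eq_of_ne' h]; simp
        rw [Finsupp.sub_apply, Finsupp.smul_apply, hx, this, sub_zero]))
        (z - z l • normOp R p f (Finsupp.single l (1 : R)))
        (Submodule.sub_mem _ hz (Submodule.smul_mem _ _ hNS))
        (by rw [map_sub, h0, map_smul, diffOp_normOp hfp hls]; simp) rfl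
    refine ⟨a + z l • Finsupp.single l 1, Submodule.add_mem _ ha (Submodule.smul_mem _ _ hls),
      w, hw, ?_⟩
    rw [map_add, map_smul, add_right_comm, ← h]
    simp

lemma exists_of_normOp_eq_zero {p : ℕ} (hp : p.Prime) {f : X → X} (hf : Function.Injective f)
    {S : Set X} (hS : MapsTo f S S) (hfp : ∀ x ∈ S, f^[p] x = x) (z : X →₀ R)
    (hz : z ∈ Finsupp.supported R R S) (h0 : normOp R p f z = 0) :
    ∃ a ∈ Finsupp.supported R R S, ∃ w ∈ Finsupp.supported R R {x ∈ S | f x = x},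
      z = diffOp R f a + w := by
  induction hn : z.support.card using Nat.strong_induction_on generalizing z with
  | _ n ih =>
    by_cases hfix : ∀ x ∈ z.support, f x = x
    · exact ⟨0, Submodule.zero_mem _, z, (Finsupp.mem_supported R z).2 fun x hx =>
        ⟨(Finsupp.mem_supported R z).1 hz hx, hfix x hx⟩, by simp⟩
    push Not at hfix
    obtain ⟨l, hl, hfl⟩ := hfix
    have hlS : l ∈ S := (Finsupp.mem_supported R z).1 hz hl
    obtain ⟨j, hj⟩ : ∃ j, f^[j] l ≠ l ∧ z (f^[j] l) ≠ 0 := by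
      by_contra! hcon
      have h1 : normOp R p f z l = z l := by
        have hterm : ∀ i ∈ Finset.range p, Finsupp.mapDomain f^[i] z l = z (f^[p - i] l) := by
          intro i hi
          conv_lhs => rw [← hfp l hlS,
            ← Nat.add_sub_cancel' (Finset.mem_range.1 hi).le, Function.iterate_add_apply]
          exact Finsupp.mapDomain_apply (hf.iterate i) z _
        rw [normOp_apply, Finsupp.finsetSum_apply, Finset.sum_congr rfl hterm,
          Finset.sum_eq_single 0]
        · simp [hfp l hlS]
        · intro i hi hi0
          have := Finset.mem_range.1 hi
          exact hcon _ fun h => hfl (fixed_of_iterate hp (hfp l hlS) (by omega) (by omega) h)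
        · intro h; exact absurd (Finset.mem_range.2 hp.pos) h
      rw [h0] at h1
      exact (Finsupp.mem_support_iff.1 hl) h1.symm
    obtain ⟨hj1, hj2⟩ := hj
    set b : X →₀ R := ∑ i ∈ Finset.range j, Finsupp.single (f^[i] l) 1 with hb
    have hbS : b ∈ Finsupp.supported R R S :=
      Submodule.sum_mem _ fun i _ => Finsupp.single_mem_supported R _ (hS.iterate i hlS)
    have hbd : diffOp R f b = Finsupp.single l 1 - Finsupp.single (f^[j] l) 1 := by
      rw [hb, map_sum]
      have : ∀ i, diffOp R f (Finsupp.single (f^[i] l) 1) =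
          Finsupp.single (f^[i] l) 1 - Finsupp.single (f^[i + 1] l) 1 := by
        intro i
        simp [diffOp_apply, Function.iterate_succ_apply']
      simp only [this]
      rw [Finset.sum_range_sub']
      simp
    have hdS : diffOp R f b ∈ Finsupp.supported R R S := by
      rw [hbd]
      exact Submodule.sub_mem _ (Finsupp.single_mem_supported R _ hlS)
        (Finsupp.single_mem_supported R _ (hS.iterate j hlS))
    obtain ⟨a, ha, w, hw, h⟩ := ih _ (hn ▸ support_erase_aux (z' := z - z l • diffOp R f b) hl
      (by simp [hbd, hj1]) (by
        intro x hx
        have h1 : l ≠ x := fun h => Finsupp.mem_support_iff.1 hl (h ▸ hx)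
        have h2 : f^[j] l ≠ x := fun h => hj2 (h ▸ hx)
        simp [hbd, hx, h1, h2])) (z - z l • diffOp R f b)
        (Submodule.sub_mem _ hz (Submodule.smul_mem _ _ hdS))
        (by rw [map_sub, h0, map_smul, normOp_diffOp hfp hbS]; simp) rfl
    refine ⟨a + z l • b, Submodule.add_mem _ ha (Submodule.smul_mem _ _ hbS), w, hw, ?_⟩
    rw [map_add, map_smul, add_right_comm, ← h]
    simp

end Cyclic

end TupleChain

section CoverOrder

variable {X Y : Type} [TopologicalSpace X] [TopologicalSpace Y]

/-- Every finite open cover of `K` can be shrunk so that each point of `K` lies in at most `D`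
members of it. -/
def CoverOrderLE (K : Set X) (D : ℕ) : Prop :=
  ∀ (ι : Type) [Finite ι] (U : ι → Set X), (∀ i, IsOpen (U i)) → K ⊆ ⋃ i, U i →
    ∃ W : ι → Set X, (∀ i, IsOpen (W i)) ∧ (∀ i, W i ⊆ U i) ∧ K ⊆ ⋃ i, W i ∧
      ∀ x ∈ K, {i | x ∈ W i}.ncard ≤ D

lemma CoverOrderLE.mono {K L : Set X} {D : ℕ} (hL : CoverOrderLE L D) (hK : IsClosed K)
    (hKL : K ⊆ L) : CoverOrderLE K D := by
  intro ι _ U hU hc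
  obtain ⟨W, hW, hWU, hWc, hWo⟩ := hL (Option ι) (fun o => o.elim Kᶜ U)
    (by rintro (_ | i); exacts [hK.isOpen_compl, hU i]) (by
      intro x _
      by_cases hx : x ∈ K
      · obtain ⟨i, hi⟩ := mem_iUnion.1 (hc hx)
        exact mem_iUnion.2 ⟨some i, hi⟩
      · exact mem_iUnion.2 ⟨none, hx⟩)
  refine ⟨fun i => W (some i), fun i => hW _, fun i => hWU (some i), fun x hx => ?_,
    fun x hx => ?_⟩
  · obtain ⟨i, hi⟩ := mem_iUnion.1 (hWc (hKL hx))
    cases i with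
    | none => exact absurd hx (hWU none hi)
    | some i => exact mem_iUnion.2 ⟨i, hi⟩
  · refine le_trans ?_ (hWo x (hKL hx))
    rw [← ncard_image_of_injective _ (Option.some_injective ι)]
    refine ncard_le_ncard ?_ (toFinite _)
    rintro _ ⟨i, hi, rfl⟩
    exact hi

lemma CoverOrderLE.union {K L : Set X} {D : ℕ} (hK : CoverOrderLE K D) (hL : CoverOrderLE L D)
    (hKc : IsClosed K) (hLc : IsClosed L) : CoverOrderLE (K ∪ L) D := by
  have shrink : ∀ {A : Set X}, CoverOrderLE A D → IsClosed A → ∀ (ι : Type) [Finite ι]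
      (U : ι → Set X), (∀ i, IsOpen (U i)) → A ⊆ ⋃ i, U i → ∃ V : ι → Set X, (∀ i, IsOpen (V i)) ∧
        (∀ i, V i ⊆ U i) ∧ (⋃ i, U i) ⊆ (⋃ i, V i) ∧ ∀ x ∈ A, {i | x ∈ V i}.ncard ≤ D := by
    intro A hA hAc ι _ U hU hc
    obtain ⟨W, hW, hWU, hWc, hWo⟩ := hA ι U hU hc
    refine ⟨fun i => U i ∩ (Aᶜ ∪ W i), fun i => (hU i).inter (hAc.isOpen_compl.union (hW i)),
      fun i => inter_subset_left, fun x hx => ?_, fun x hx => ?_⟩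
    · by_cases hxA : x ∈ A
      · obtain ⟨i, hi⟩ := mem_iUnion.1 (hWc hxA)
        exact mem_iUnion.2 ⟨i, hWU i hi, Or.inr hi⟩
      · obtain ⟨i, hi⟩ := mem_iUnion.1 hx
        exact mem_iUnion.2 ⟨i, hi, Or.inl hxA⟩
    · refine le_trans (ncard_le_ncard ?_ (toFinite _)) (hWo x hx)
      rintro i ⟨-, hi | hi⟩
      · exact absurd hx hi
      · exact hi
  intro ι _ U hU hc
  obtain ⟨V, hV, hVU, hVc, hVo⟩ := shrink hK hKc ι U hU (subset_union_left.trans hc)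
  obtain ⟨W, hW, hWV, hWc, hWo⟩ := shrink hL hLc ι V hV ((subset_union_right.trans hc).trans hVc)
  refine ⟨W, hW, fun i => (hWV i).trans (hVU i), (hc.trans hVc).trans hWc, ?_⟩
  rintro x (hx | hx)
  · exact le_trans (ncard_le_ncard (fun i hi => hWV i hi) (toFinite _)) (hVo x hx)
  · exact hWo x hx

lemma coverOrderLE_of_isCompact [T2Space X] {D : ℕ}
    (h : ∀ x : X, ∃ s ∈ 𝓝 x, IsClosed s ∧ CoverOrderLE s D) {K : Set X} (hK : IsCompact K) :
    CoverOrderLE K D := by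
  obtain ⟨s, hs, hsc, hsD⟩ : ∃ s, K ⊆ s ∧ IsClosed s ∧ CoverOrderLE s D := by
    refine hK.induction_on (p := fun K => ∃ s, K ⊆ s ∧ IsClosed s ∧ CoverOrderLE s D) ?_ ?_ ?_ ?_
    · refine ⟨∅, subset_rfl, isClosed_empty, fun ι _ U _ _ => ⟨fun _ => ∅, ?_⟩⟩
      simp
    · rintro s t hst ⟨u, hu, h⟩
      exact ⟨u, hst.trans hu, h⟩
    · rintro s t ⟨u, hu, huc, huD⟩ ⟨v, hv, hvc, hvD⟩
      exact ⟨u ∪ v, union_subset_union hu hv, huc.union hvc, huD.union hvD huc hvc⟩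
    · intro x _
      obtain ⟨s, hs, h⟩ := h x
      exact ⟨s, mem_nhdsWithin_of_mem_nhds hs, s, subset_rfl, h⟩
  exact hsD.mono hK.isClosed hs

lemma CoverOrderLE.image_symm (e : OpenPartialHomeomorph X Y) {C : Set Y} (hC : C ⊆ e.target)
    {D : ℕ} (h : CoverOrderLE C D) : CoverOrderLE (e.symm '' C) D := by
  intro ι _ U hU hc
  obtain ⟨W, hW, hWU, hWc, hWo⟩ := h ι (fun i => e.target ∩ e.symm ⁻¹' U i)
    (fun i => e.isOpen_inter_preimage_symm (hU i)) (by
      intro y hy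
      obtain ⟨i, hi⟩ := mem_iUnion.1 (hc (mem_image_of_mem _ hy))
      exact mem_iUnion.2 ⟨i, hC hy, hi⟩)
  refine ⟨fun i => e.source ∩ e ⁻¹' W i, fun i => e.isOpen_inter_preimage (hW i), ?_, ?_, ?_⟩
  · rintro i x ⟨hx, hxW⟩
    have := (hWU i hxW).2
    rwa [mem_preimage, e.left_inv hx] at this
  · rintro _ ⟨y, hy, rfl⟩
    obtain ⟨i, hi⟩ := mem_iUnion.1 (hWc hy)
    refine mem_iUnion.2 ⟨i, e.map_target (hC hy), ?_⟩
    rwa [mem_preimage, e.right_inv (hC hy)]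
  · rintro _ ⟨y, hy, rfl⟩
    refine le_trans (ncard_le_ncard ?_ (toFinite _)) (hWo y hy)
    rintro i ⟨-, hi⟩
    rwa [mem_preimage, e.right_inv (hC hy)] at hi

lemma coverOrderLE_pi (n : ℕ) {C : Set (Fin n → ℝ)} (hC : IsCompact C) :
    CoverOrderLE C (2 ^ n) := by
  intro ι _ U hU hc
  obtain ⟨δ, hδ, hL⟩ := lebesgue_number_lemma_of_metric hC hU hc
  set a : ℝ := δ / 2 with ha
  have ha0 : 0 < a := by positivity
  let c : (Fin n → ℤ) → (Fin n → ℝ) := fun z i => a * z i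
  have hmem : ∀ (x : Fin n → ℝ) (z : Fin n → ℤ), x ∈ ball (c z) a → 
      z ∈ Fintype.piFinset fun i => ({⌊x i / a⌋, ⌊x i / a⌋ + 1} : Finset ℤ) := by
    intro x z hx
    rw [Fintype.mem_piFinset]
    intro i
    have h1 : |x i - a * z i| < a := by
      have := (dist_pi_lt_iff ha0).1 (mem_ball.1 hx) i
      rwa [Real.dist_eq] at this
    have h2 : |x i / a - z i| < 1 := by
      have : x i / a - z i = (x i - a * z i) / a := by field_simp
      rw [this, abs_div, abs_of_pos ha0, div_lt_one ha0]
      exact h1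
    obtain ⟨h3, h4⟩ := abs_lt.1 h2
    have h5 := Int.floor_le (x i / a)
    have h6 := Int.lt_floor_add_one (x i / a)
    have h7 : (⌊x i / a⌋ : ℝ) < z i + 1 := by linarith
    have h8 : (z i : ℝ) < ⌊x i / a⌋ + 2 := by linarith
    have h7' : ⌊x i / a⌋ < z i + 1 := by exact_mod_cast h7
    have h8' : z i < ⌊x i / a⌋ + 2 := by exact_mod_cast h8
    simp only [Finset.mem_insert, Finset.mem_singleton]
    omega
  have hex : ∀ x : Fin n → ℝ, ∃ z, x ∈ ball (c z) a := by
    intro x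
    refine ⟨fun i => round (x i / a), ?_⟩
    rw [mem_ball, dist_pi_lt_iff ha0]
    intro i
    have h1 := abs_sub_round (x i / a)
    have h2 : x i - a * round (x i / a) = a * (x i / a - round (x i / a)) := by field_simp
    rw [Real.dist_eq, h2, abs_mul, abs_of_pos ha0]
    nlinarith
  have hchoice : ∀ z : Fin n → ℤ, ∃ i : Option ι, (i = none → Disjoint (ball (c z) a) C) ∧
      ∀ j, i = some j → ball (c z) a ⊆ U j := by
    intro z
    by_cases hd : Disjoint (ball (c z) a) C
    · exact ⟨none, fun _ => hd, by simp⟩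
    · obtain ⟨x, hx, hxC⟩ := not_disjoint_iff.1 hd
      obtain ⟨j, hj⟩ := hL x hxC
      refine ⟨some j, by simp, ?_⟩
      rintro _ ⟨⟩
      refine (ball_subset_ball' ?_).trans hj
      have := mem_ball'.1 hx
      linarith
  choose k hk1 hk2 using hchoice
  refine ⟨fun i => ⋃ z ∈ {z | k z = some i}, ball (c z) a,
    fun i => isOpen_biUnion fun _ _ => isOpen_ball,
    fun i => iUnion₂_subset fun z hz => hk2 z i hz, fun x hx => ?_, fun x hx => ?_⟩
  · obtain ⟨z, hz⟩ := hex x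
    cases h : k z with
    | none => exact absurd hx (disjoint_left.1 (hk1 z h) hz)
    | some i => exact mem_iUnion.2 ⟨i, mem_biUnion (show z ∈ {z | k z = some i} from h) hz⟩
  · have hsub : some '' {i | x ∈ ⋃ z ∈ {z | k z = some i}, ball (c z) a} ⊆
        k '' (Fintype.piFinset fun i => ({⌊x i / a⌋, ⌊x i / a⌋ + 1} : Finset ℤ)) := by
      rintro _ ⟨i, hi, rfl⟩
      obtain ⟨z, hz, hxz⟩ := mem_iUnion₂.1 hi
      exact ⟨z, hmem x z hxz, hz⟩
    rw [← ncard_image_of_injective _ (Option.some_injective ι)]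
    refine (ncard_le_ncard hsub (toFinite _)).trans ((ncard_image_le (toFinite _)).trans ?_)
    rw [ncard_coe_finset, Fintype.card_piFinset]
    refine (Finset.prod_le_prod' fun i _ => Finset.card_le_two).trans ?_
    simp

/-- A connected space covered by Euclidean charts has a uniform bound on the order of covers,
irrespective of the dimensions of the charts. -/
lemma exists_coverOrderLE [T2Space X] [ConnectedSpace X]
    (hch : ∀ x : X, ∃ (n : ℕ) (e : OpenPartialHomeomorph X (Fin n → ℝ)), x ∈ e.source) :
    ∃ D, ∀ K : Set X, IsCompact K → CoverOrderLE K D := by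
  have hnhds : ∀ {n : ℕ} (e : OpenPartialHomeomorph X (Fin n → ℝ)) {x : X}, x ∈ e.source →
      ∀ s ∈ 𝓝 x, ∃ ρ > 0, closedBall (e x) ρ ⊆ e.target ∧ e.symm '' closedBall (e x) ρ ⊆ s := by
    intro n e x hx s hs
    have h1 : e.target ∩ e.symm ⁻¹' s ∈ 𝓝 (e x) := by
      refine inter_mem (e.open_target.mem_nhds (e.map_source hx)) ?_
      exact (e.tendsto_symm hx) hs
    obtain ⟨ρ, hρ, h⟩ := nhds_basis_closedBall.mem_iff.1 h1
    exact ⟨ρ, hρ, fun y hy => (h hy).1, image_subset_iff.2 fun y hy => (h hy).2⟩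
  have hcpt : ∀ {n : ℕ} (e : OpenPartialHomeomorph X (Fin n → ℝ)) {C : Set (Fin n → ℝ)},
      IsCompact C → C ⊆ e.target → IsClosed (e.symm '' C) := by
    intro n e C hC hCt
    exact (hC.image_of_continuousOn (e.continuousOn_symm.mono hCt)).isClosed
  obtain ⟨x₀⟩ : Nonempty X := inferInstance
  obtain ⟨n₀, e₀, hx₀⟩ := hch x₀
  have hsymm : ∀ {n : ℕ} (e : OpenPartialHomeomorph X (Fin n → ℝ)) {x : X}, x ∈ e.source →
      ∀ ρ > 0, closedBall (e x) ρ ⊆ e.target → e.symm '' closedBall (e x) ρ ∈ 𝓝 x := by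
    intro n e x hx ρ hρ hρt
    have := e.symm.image_mem_nhds (x := e x) (e.map_source hx) (closedBall_mem_nhds (e x) hρ)
    rwa [e.left_inv hx] at this
  let S : Set X := {x | ∃ s ∈ 𝓝 x, IsClosed s ∧ CoverOrderLE s (2 ^ n₀)}
  have hSo : IsOpen S := by
    rw [isOpen_iff_mem_nhds]
    rintro x ⟨s, hs, h⟩
    filter_upwards [eventually_mem_nhds_iff.2 hs] with y hy
    exact ⟨s, hy, h⟩
  have hS₀ : x₀ ∈ S := by
    obtain ⟨ρ, hρ, hρt, -⟩ := hnhds e₀ hx₀ univ univ_mem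
    exact ⟨_, hsymm e₀ hx₀ ρ hρ hρt, hcpt e₀ (isCompact_closedBall _ _) hρt,
      (coverOrderLE_pi n₀ (isCompact_closedBall _ _)).image_symm e₀ hρt⟩
  have hSc : IsClosed S := by
    refine isClosed_of_closure_subset fun y hy => ?_
    obtain ⟨m, e, hye⟩ := hch y
    obtain ⟨x, hxe, s, hs, hsc, hsD⟩ := mem_closure_iff.1 hy e.source e.open_source hye
    obtain ⟨ρ, hρ, hρt, hρs⟩ := hnhds e hxe s hs
    obtain ⟨r, hr, hrt, -⟩ := hnhds e hye univ univ_mem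
    refine ⟨_, hsymm e hye r hr hrt, hcpt e (isCompact_closedBall _ _) hrt, ?_⟩
    refine CoverOrderLE.image_symm e hrt ?_
    have h1 : CoverOrderLE (e.symm '' closedBall (e x) ρ) (2 ^ n₀) :=
      hsD.mono (hcpt e (isCompact_closedBall _ _) hρt) hρs
    have h2 : CoverOrderLE (closedBall (e x) ρ) (2 ^ n₀) := by
      have := h1.image_symm e.symm (by
        rintro _ ⟨z, hz, rfl⟩
        exact e.map_target (hρt hz))
      rwa [e.symm_symm, image_image, image_congr fun z hz => e.right_inv (hρt hz),
        image_id'] at this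
    let T : (Fin m → ℝ) ≃ₜ (Fin m → ℝ) :=
      (Homeomorph.subRight (e y)).trans ((Homeomorph.smulOfNeZero (ρ / r) (by positivity)).trans
        (Homeomorph.addRight (e x)))
    have h3 := h2.image_symm T.toOpenPartialHomeomorph (by simp)
    refine h3.mono isClosed_closedBall fun z hz => ⟨T z, ?_, by simp⟩
    have : T z - e x = (ρ / r) • (z - e y) := by simp [T]
    rw [mem_closedBall, dist_eq_norm, this, norm_smul, Real.norm_of_nonneg (by positivity)]
    rw [mem_closedBall, dist_eq_norm] at hz
    calc ρ / r * ‖z - e y‖ ≤ ρ / r * r := by gcongr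
      _ = ρ := by field_simp
  have hSu : S = univ := IsClopen.eq_univ ⟨hSc, hSo⟩ ⟨x₀, hS₀⟩
  exact ⟨2 ^ n₀, fun K hK =>
    coverOrderLE_of_isCompact (fun x => (hSu.symm ▸ mem_univ x : x ∈ S)) hK⟩

end CoverOrder

namespace TupleChain

section Small

variable {X : Type} [PseudoMetricSpace X]

/-- The tuples of length `n` with entries in `K` at mutual distance less than `ε`. -/
def Small (K : Set X) (ε : ℝ) (n : ℕ) : Set (List X) :=
  {l | l.length = n ∧ ∀ x ∈ l, x ∈ K ∧ ∀ y ∈ l, dist x y < ε}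

lemma Small.mono {K L : Set X} (h : K ⊆ L) {ε δ : ℝ} (hεδ : ε ≤ δ) (n : ℕ) :
    Small K ε n ⊆ Small L δ n :=
  fun _ hl => ⟨hl.1, fun x hx => ⟨h (hl.2 x hx).1, fun y hy => ((hl.2 x hx).2 y hy).trans_le hεδ⟩⟩

lemma Small.face {K : Set X} {ε : ℝ} (n : ℕ) : ∀ l ∈ Small K ε (n + 1), ∀ m : List X,
    m.Sublist l → m.length + 1 = l.length → m ∈ Small K ε n := by
  rintro l ⟨h1, h2⟩ m hm hl
  exact ⟨by omega, fun x hx =>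
    ⟨(h2 x (hm.subset hx)).1, fun y hy => (h2 x (hm.subset hx)).2 y (hm.subset hy)⟩⟩

lemma Small.map {Y : Type} [PseudoMetricSpace Y] {f : X → Y} (hf : Isometry f) {K : Set X}
    {L : Set Y} (hK : MapsTo f K L) {ε : ℝ} {n : ℕ} :
    ∀ l ∈ Small K ε n, l.map f ∈ Small L ε n := by
  rintro l ⟨h1, h2⟩
  refine ⟨by simpa using h1, ?_⟩
  simp only [List.mem_map, forall_exists_index, and_imp, forall_apply_eq_imp_iff₂, hf.dist_eq]
  exact fun x hx => ⟨hK (h2 x hx).1, (h2 x hx).2⟩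

end Small

lemma isometry_iterate {X : Type} [PseudoMetricSpace X] {g : X → X} (hg : Isometry g) :
    ∀ i, Isometry g^[i]
  | 0 => isometry_id
  | i + 1 => (isometry_iterate hg i).comp hg

lemma exists_orbit_colour {X : Type} {g : X → X} {p : ℕ} (hp : 0 < p)
    (hgp : ∀ x, g^[p] x = x) : ∃ (O : Type) (_ : LinearOrder O) (col : X → O),
      (∀ x, col (g x) = col x) ∧ ∀ x y, col x = col y → ∃ i, g^[i] x = y := by
  refine ⟨Set X, IsWellOrder.linearOrder WellOrderingRel, fun x => range fun i => g^[i] x, ?_, ?_⟩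
  · intro x
    ext y
    constructor
    · rintro ⟨i, rfl⟩
      exact ⟨i + 1, rfl⟩
    · rintro ⟨i, rfl⟩
      refine ⟨i + (p - 1), ?_⟩
      have : i + (p - 1) + 1 = i + p := by omega
      change g^[i + (p - 1) + 1] x = _
      rw [this, Function.iterate_add_apply, hgp]
  · intro x y h
    exact h.symm.subset (⟨0, rfl⟩ : y ∈ range fun i => g^[i] y)

section Cover

variable {X : Type} [MetricSpace X]

lemma exists_invariant_radius {g : X → X} (hg : Isometry g) {p : ℕ} (hp : 0 < p)
    (hgp : ∀ x, g^[p] x = x) {ε : ℝ} (hε : 0 < ε) :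
    ∃ r : X → ℝ, (∀ x, 0 < r x) ∧ (∀ x, r x ≤ ε) ∧ (∀ x, r (g x) = r x) ∧
      ∀ x i, g^[i] x ≠ x → 2 * r x ≤ dist x (g^[i] x) := by
  classical
  have hne : (Finset.range p).Nonempty := ⟨0, by simpa using hp⟩
  refine ⟨fun x => (Finset.range p).inf' hne fun i =>
    if g^[i] x = x then ε else min ε (dist x (g^[i] x) / 2), fun x => ?_, fun x => ?_, fun x => ?_,
    fun x i hi => ?_⟩
  · rw [Finset.lt_inf'_iff]
    intro i _
    split_ifs with h
    · exact hε
    · exact lt_min hε (half_pos (dist_pos.2 (Ne.symm h)))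
  · refine (Finset.inf'_le _ (Finset.mem_range.2 hp)).trans ?_
    simp
  · refine Finset.inf'_congr hne rfl fun i _ => ?_
    rw [(Function.Commute.iterate_self g i).eq x]
    simp only [hg.injective.eq_iff, hg.dist_eq]
  · have hi' : g^[i % p] x = g^[i] x := by
      conv_rhs => rw [← Nat.mod_add_div i p, Function.iterate_add_apply, Function.iterate_mul,
        Function.iterate_fixed (hgp x)]
    have h := Finset.inf'_le (s := Finset.range p)
      (fun i => if g^[i] x = x then ε else min ε (dist x (g^[i] x) / 2))
      (Finset.mem_range.2 (Nat.mod_lt i hp))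
    simp only [hi', if_neg hi] at h
    have := h.trans (min_le_right _ _)
    linarith

/-- A compact metric space with a periodic isometry has fine invariant covers of bounded order
whose members are displaced by the isometry or preserved by it. -/
lemma exists_invariant_cover [CompactSpace X] {g : X → X} (hg : Isometry g) {p : ℕ} (hp : 0 < p)
    (hgp : ∀ x, g^[p] x = x) {D : ℕ} (hD : CoverOrderLE (univ : Set X) D) {ε : ℝ} (hε : 0 < ε) :
    ∃ W : X → Set X, (∀ t, IsOpen (W t)) ∧ (∀ t, ∀ x ∈ W t, dist x t < ε) ∧
      (∀ t x, g x ∈ W (g t) ↔ x ∈ W t) ∧ (∀ x, ∃ t, x ∈ W t) ∧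
      (∀ x t i, x ∈ W t → x ∈ W (g^[i] t) → g^[i] t = t) ∧
      ∀ x, {t | x ∈ W t}.Finite ∧ {t | x ∈ W t}.ncard ≤ p * D := by
  obtain ⟨r, hr0, hrε, hrg, hrd⟩ := exists_invariant_radius hg hp hgp hε
  have hrg' : ∀ i x, r (g^[i] x) = r x := by
    intro i x
    induction i generalizing x with
    | zero => rfl
    | succ i ih => rw [Function.iterate_succ_apply, ih, hrg]
  obtain ⟨T, hT⟩ := isCompact_univ.elim_nhds_subcover (fun t : X => ball t (r t))
    fun t _ => ball_mem_nhds t (hr0 t)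
  obtain ⟨V, hVo, hVs, hVc, hVD⟩ := hD T (fun t => ball (t : X) (r t)) (fun _ => isOpen_ball)
    (by
      intro x hx
      obtain ⟨t, ht, hxt⟩ := mem_iUnion₂.1 (hT.2 hx)
      exact mem_iUnion.2 ⟨⟨t, ht⟩, hxt⟩)
  obtain ⟨W, hW⟩ : ∃ W : X → Set X, ∀ t x, x ∈ W t ↔
      ∃ i < p, ∃ s : T, g^[i] t = s ∧ g^[i] x ∈ V s :=
    ⟨fun t => {x | ∃ i < p, ∃ s : T, g^[i] t = s ∧ g^[i] x ∈ V s}, fun _ _ => Iff.rfl⟩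
  have hWball : ∀ t, ∀ x ∈ W t, dist x t < r t := by
    intro t x hx
    obtain ⟨i, -, s, hs, hx⟩ := (hW t x).1 hx
    have := hVs s hx
    rwa [mem_ball, ← hs, (isometry_iterate hg i).dist_eq, hrg'] at this
  refine ⟨W, fun t => ?_, fun t x hx => (hWball t x hx).trans_le (hrε t), fun t x => ?_,
    fun x => ?_, fun x t i hx hx' => ?_, fun x => ?_⟩
  · have : W t = ⋃ i, ⋃ (_ : i < p), ⋃ s : T, ⋃ (_ : g^[i] t = s), g^[i] ⁻¹' V s := by
      ext x; simp [hW]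
    rw [this]
    exact isOpen_iUnion fun i => isOpen_iUnion fun _ => isOpen_iUnion fun s => isOpen_iUnion
      fun _ => (hVo s).preimage (hg.continuous.iterate i)
  · rw [hW, hW]
    constructor
    · rintro ⟨i, hi, s, hs, hx⟩
      rw [← Function.iterate_succ_apply] at hs hx
      rcases eq_or_lt_of_le (Nat.succ_le_of_lt hi) with h | h
      · rw [h, hgp] at hs hx
        exact ⟨0, hp, s, hs, hx⟩
      · exact ⟨i + 1, h, s, hs, hx⟩
    · rintro ⟨i, hi, s, hs, hx⟩
      cases i with
      | zero =>
        refine ⟨p - 1, by omega, s, ?_, ?_⟩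
        · rw [← Function.iterate_succ_apply, Nat.succ_eq_add_one, Nat.sub_add_cancel hp, hgp]
          exact hs
        · rw [← Function.iterate_succ_apply, Nat.succ_eq_add_one, Nat.sub_add_cancel hp, hgp]
          exact hx
      | succ i => exact ⟨i, by omega, s, hs, hx⟩
  · obtain ⟨s, hs⟩ := mem_iUnion.1 (hVc (mem_univ x))
    exact ⟨s, (hW _ _).2 ⟨0, hp, s, rfl, hs⟩⟩
  · by_contra hne
    have h1 := hWball _ _ hx
    have h2 := hWball _ _ hx'
    rw [hrg'] at h2
    have h3 := hrd t i hne
    have h4 := dist_triangle_left t (g^[i] t) x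
    linarith
  · have hsub : {t | x ∈ W t} ⊆ ⋃ i ∈ Finset.range p,
        (fun s : T => g^[p - i] s) '' {s | g^[i] x ∈ V s} := by
      intro t ht
      obtain ⟨i, hi, s, hs, hx⟩ := (hW _ _).1 ht
      refine mem_iUnion₂.2 ⟨i, Finset.mem_range.2 hi, s, hx, ?_⟩
      change g^[p - i] s = t
      rw [← hs, ← Function.iterate_add_apply, Nat.sub_add_cancel hi.le, hgp]
    have hfin : (⋃ i ∈ Finset.range p,
        (fun s : T => g^[p - i] s) '' {s | g^[i] x ∈ V s}).Finite :=
      (Finset.range p).finite_toSet.biUnion fun i _ => (toFinite _).image _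
    refine ⟨hfin.subset hsub, (ncard_le_ncard hsub hfin).trans ?_⟩
    refine (Finset.set_ncard_biUnion_le _ _).trans ?_
    refine (Finset.sum_le_card_nsmul _ _ D fun i _ => ?_).trans (by simp)
    exact (ncard_image_le (toFinite _)).trans (hVD _ (mem_univ _))

lemma exists_equivariant_vertex_map [CompactSpace X] {g : X → X} (hg : Isometry g) {p : ℕ}
    (hp : 0 < p) (hgp : ∀ x, g^[p] x = x) {D : ℕ} (hD : CoverOrderLE (univ : Set X) D) {ε : ℝ}
    (hε : 0 < ε) :
    ∃ δ > 0, ∃ (O : Type) (_ : LinearOrder O) (col : X → O) (v : X → X),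
      (∀ x, col (g x) = col x) ∧ (∀ x, v (g x) = g (v x)) ∧ (∀ x, dist x (v x) < ε) ∧
      (∀ x y z, dist x y < δ → dist x z < δ → col (v y) = col (v z) → v y = v z) ∧
      ∀ x, (v '' ball x δ).Finite ∧ (v '' ball x δ).ncard ≤ p * D := by
  obtain ⟨W, hWo, hWε, hWg, hWc, hWd, hWD⟩ := exists_invariant_cover hg hp hgp hD hε
  obtain ⟨O, _, col, hcol, hcolW⟩ := exists_orbit_colour hp hgp
  obtain ⟨δ, hδ, hL⟩ := lebesgue_number_lemma_of_metric isCompact_univ hWo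
    fun x _ => mem_iUnion.2 (hWc x)
  have huniq : ∀ x t t', x ∈ W t → x ∈ W t' → col t = col t' → t = t' := by
    intro x t t' h h' hc
    obtain ⟨i, rfl⟩ := hcolW _ _ hc
    exact (hWd x t i h h').symm
  have hsurj : ∀ x, g (g^[p - 1] x) = x := by
    intro x
    rw [← Function.iterate_succ_apply' g, Nat.succ_eq_add_one, Nat.sub_add_cancel hp, hgp]
  have hball : ∀ x t, ball (g x) δ ⊆ W (g t) ↔ ball x δ ⊆ W t := by
    intro x t
    constructor
    · intro h y hy
      rw [← hWg]
      refine h ?_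
      rwa [mem_ball, hg.dist_eq]
    · intro h y hy
      rw [← hsurj y, hWg]
      refine h ?_
      rwa [← hsurj y, mem_ball, hg.dist_eq] at hy
  have hv : ∀ x, ∃ t, ball x δ ⊆ W t ∧ ∀ t', ball x δ ⊆ W t' → col t ≤ col t' := by
    intro x
    have hfin : {t | ball x δ ⊆ W t}.Finite :=
      (hWD x).1.subset fun t ht => ht (mem_ball_self hδ)
    obtain ⟨t, ht, hmin⟩ := hfin.exists_minimalFor col _ (hL x (mem_univ x))
    exact ⟨t, ht, fun t' ht' => (le_total (col t) (col t')).elim id (hmin ht')⟩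
  choose v hv1 hv2 using hv
  refine ⟨δ, hδ, O, inferInstance, col, v, hcol, fun x => ?_, fun x => ?_, fun x y z hy hz hc => ?_,
    fun x => ?_⟩
  · refine huniq (g x) _ _ (hv1 _ (mem_ball_self hδ)) ((hball _ _).2 (hv1 x) (mem_ball_self hδ))
      (le_antisymm (hv2 _ _ ((hball _ _).2 (hv1 x))) ?_)
    rw [hcol, ← hsurj (v (g x)), hcol]
    refine hv2 _ _ ?_
    rw [← hball, hsurj]
    exact hv1 _
  · exact hWε _ _ (hv1 x (mem_ball_self hδ))
  · exact huniq x _ _ (hv1 y hy) (hv1 z hz) hc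
  · have hsub : v '' ball x δ ⊆ {t | x ∈ W t} := by
      rintro _ ⟨y, hy, rfl⟩
      exact hv1 y (mem_ball_comm.1 hy)
    exact ⟨(hWD x).1.subset hsub, (ncard_le_ncard hsub (hWD x).1).trans (hWD x).2⟩

/-- Above the order of its invariant covers, the chains of small tuples of a compact metric space
with a periodic isometry are equivariantly contractible. -/
lemma exists_equivariant_homotopy (R : Type) [CommRing R] [CompactSpace X] {g : X → X}
    (hg : Isometry g) {p : ℕ} (hp : 0 < p) (hgp : ∀ x, g^[p] x = x) {D : ℕ}
    (hD : CoverOrderLE (univ : Set X) D) {ε : ℝ} (hε : 0 < ε) :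
    ∃ δ > 0, ∃ H : ℕ → (List X →₀ R) →ₗ[R] (List X →₀ R),
      (∀ n z, H n (push g z) = push g (H n z)) ∧
      (∀ n ≥ p * D, ∀ z ∈ Finsupp.supported R R (Small univ δ (n + 1)),
        bd (H (n + 1) z) + H n (bd z) = z) ∧
      ∀ n, ∀ z ∈ Finsupp.supported R R (Small univ δ n),
        H n z ∈ Finsupp.supported R R (Small univ ε (n + 1)) := by
  obtain ⟨δ, hδ, O, _, col, v, hcol, hvg, hvε, hinj, hcard⟩ :=
    exists_equivariant_vertex_map hg hp hgp hD (ε := ε / 3) (by linarith)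
  set δ' := min δ (ε / 3)
  have hδ' : δ' ≤ δ := min_le_left _ _
  let A : ℕ → (List X →₀ R) →ₗ[R] (List X →₀ R) := fun n =>
    LinearMap.id - sortOp col n ∘ₗ push v
  have hA' : ∀ n z, A n z = z - sortOp col n (push v z) := fun _ _ => rfl
  have hcolInj : ∀ n, ∀ l ∈ Small (univ : Set X) δ' n, l.map v ∈ colorInj col n := by
    rintro n l ⟨h1, h2⟩
    refine ⟨by simpa using h1, ?_⟩
    simp only [List.mem_map, forall_exists_index, and_imp, forall_apply_eq_imp_iff₂]
    exact fun x hx y hy =>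
      hinj x x y (by simpa using hδ) (((h2 x hx).2 y hy).trans_le hδ')
  have hbdA : ∀ n, ∀ l ∈ Small (univ : Set X) δ' (n + 1),
      bd (A (n + 1) (Finsupp.single l (1 : R))) = A n (bd (Finsupp.single l 1)) := by
    intro n l hl
    rw [hA', hA', map_sub, push_single, bd_sortOp col n _ (hcolInj _ l hl), ← bd_push,
      push_single]
  have hAmem : ∀ n, ∀ l ∈ Small (univ : Set X) δ' n, A n (Finsupp.single l (1 : R)) ∈
      Finsupp.supported R R (carrier (fun x y => y = x ∨ y = v x) l n) := by
    intro n l hl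
    rw [hA', push_single]
    refine Submodule.sub_mem _ (Finsupp.single_mem_supported R _
      ⟨hl.1, fun y hy => ⟨y, hy, Or.inl rfl⟩⟩)
      (Finsupp.supported_mono ?_ (sortOp_mem col n _ (hcolInj n l hl)))
    rintro m ⟨-, h2, h3⟩
    refine ⟨h2, fun y hy => ?_⟩
    obtain ⟨x, hx, rfl⟩ := List.mem_map.1 (h3 y hy)
    exact ⟨x, hx, Or.inr rfl⟩
  refine ⟨δ', lt_min hδ (by linarith), homotopyOp id A, fun n z => ?_, fun n hn z hz => ?_,
    fun n z hz => ?_⟩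
  · refine push_homotopyOp g id (fun _ => rfl) A (fun n z => ?_) n z
    have : push v (push g z) = push g (push v z) := by
      have : (push v ∘ₗ push g : (List X →₀ R) →ₗ[R] _) = push g ∘ₗ push v :=
        linearMap_ext fun l => by simp [Function.comp_def, hvg]
      exact LinearMap.congr_fun this z
    rw [hA', hA', this, push_sortOp col g hg.injective hcol, map_sub]
  · rw [bd_homotopyOp id A (Small univ δ') (fun _ _ h => h.1) Small.face ?_ hbdA n hz, hA']
    · rw [sub_eq_self]
      refine (map_eq_of_supported (sortOp col (n + 1) ∘ₗ push v) 0 (fun l hl => ?_) hz)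
      have h := sortOp_mem (R := R) col (n + 1) _ (hcolInj _ l hl)
      rw [LinearMap.comp_apply, push_single]
      suffices hempty : {m | m ∈ increasing col ∧ m.length = n + 1 ∧ ∀ x ∈ m, x ∈ l.map v} = ∅ by
        rw [hempty] at h
        simpa using h
      refine eq_empty_of_forall_notMem ?_
      rintro m ⟨h1, h2, h3⟩
      obtain ⟨a, ha⟩ : ∃ a, a ∈ l :=
        List.exists_mem_of_length_pos (by have := hl.1; omega)
      have hnd : m.Nodup := List.Pairwise.imp (fun h => fun he => h.ne (congrArg col he)) h1
      have hsub : {y | y ∈ m} ⊆ v '' ball a δ := by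
        intro y hy
        obtain ⟨x, hx, rfl⟩ := List.mem_map.1 (h3 y hy)
        exact ⟨x, ((hl.2 x hx).2 a ha).trans_le hδ', rfl⟩
      have h4 := (ncard_le_ncard hsub (hcard a).1).trans (hcard a).2
      classical
      rw [← List.coe_toFinset, ncard_coe_finset, List.toFinset_card_of_nodup hnd] at h4
      omega
    · intro l hl
      rw [List.length_eq_zero_iff.1 hl.1, hA', push_single, sortOp_zero, sub_self]
  · refine map_mem_of_supported _ (fun l hl => ?_) hz
    refine Finsupp.supported_mono ?_ (homotopyOp_mem id A _ (fun a => Or.inl rfl)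
      (Small univ δ') (fun _ _ h => h.1) Small.face hAmem n l hl)
    rintro m ⟨h1, h2⟩
    have hclose : ∀ y ∈ m, ∃ x ∈ l, dist x y < ε / 3 := by
      intro y hy
      obtain ⟨x, hx, rfl | rfl⟩ := h2 y hy
      · exact ⟨y, hx, by rw [dist_self]; linarith⟩
      · exact ⟨x, hx, hvε x⟩
    refine ⟨h1, fun y hy => ⟨mem_univ _, fun y' hy' => ?_⟩⟩
    obtain ⟨x, hx, hxy⟩ := hclose y hy
    obtain ⟨x', hx', hxy'⟩ := hclose y' hy'
    have h3 : dist x x' < ε / 3 := ((hl.2 x hx).2 x' hx').trans_le (min_le_right _ _)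
    have h4 := dist_triangle4 y x x' y'
    rw [dist_comm y x] at h4
    linarith

end Cover

section Smith

lemma aeval_intertwine {R P Q : Type} [CommRing R] [AddCommGroup P] [Module R P] [AddCommGroup Q]
    [Module R Q] (T : P →ₗ[R] Q) (A : Module.End R P) (B : Module.End R Q)
    (h : ∀ z, T (A z) = B (T z)) (q : Polynomial R) (z : P) :
    T (Polynomial.aeval A q z) = Polynomial.aeval B q (T z) := by
  have hpow : ∀ (n : ℕ) (z : P), T ((A ^ n) z) = (B ^ n) (T z) := by
    intro n
    induction n with
    | zero => simp
    | succ n ih => intro z; rw [pow_succ, pow_succ, Module.End.mul_apply, ih, h]; rfl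
  simp [Polynomial.aeval_eq_sum_range, hpow]

lemma aeval_mem {R P : Type} [CommRing R] [AddCommGroup P] [Module R P] (A : Module.End R P)
    {N : Submodule R P} (h : ∀ z ∈ N, A z ∈ N) (q : Polynomial R) {z : P} (hz : z ∈ N) :
    Polynomial.aeval A q z ∈ N := by
  have hpow : ∀ (n : ℕ), (A ^ n) z ∈ N := by
    intro n
    induction n with
    | zero => simpa
    | succ n ih => rw [pow_succ']; exact h _ ih
  rw [Polynomial.aeval_eq_sum_range, LinearMap.sum_apply]
  exact Submodule.sum_mem _ fun i _ => Submodule.smul_mem _ _ (hpow i)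

/-- The operators `1 - g` and `1 + g + ⋯ + g ^ (p - 1)` on chains of tuples. -/
noncomputable def smithOp (R : Type) [CommRing R] {X : Type} (p : ℕ) (g : X → X) (b : Bool) :
    (List X →₀ R) →ₗ[R] (List X →₀ R) :=
  Polynomial.aeval (push g : Module.End R (List X →₀ R))
    (if b then 1 - Polynomial.X else ∑ i ∈ Finset.range p, Polynomial.X ^ i : Polynomial R)

variable {R X : Type} [CommRing R]

lemma smithOp_true (p : ℕ) (g : X → X) : smithOp R p g true = diffOp R (List.map g) := by
  simp only [smithOp, if_true, map_sub, map_one, Polynomial.aeval_X]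
  rfl

lemma smithOp_false (p : ℕ) (g : X → X) : smithOp R p g false = normOp R p (List.map g) := by
  have hpow : ∀ n : ℕ, (push g : Module.End R (List X →₀ R)) ^ n =
      Finsupp.lmapDomain R R (List.map g)^[n] := by
    intro n
    induction n with
    | zero =>
      refine linearMap_ext fun l => ?_
      simp
    | succ n ih =>
      refine linearMap_ext fun l => ?_
      rw [pow_succ, Module.End.mul_apply, ih]
      simp
  simp [smithOp, normOp, hpow]

lemma smithOp_intertwine {Y : Type} (p : ℕ) {g : X → X} {h : Y → Y}
    (T : (List X →₀ R) →ₗ[R] (List Y →₀ R)) (hT : ∀ z, T (push g z) = push h (T z)) (b : Bool)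
    (z : List X →₀ R) : T (smithOp R p g b z) = smithOp R p h b (T z) :=
  aeval_intertwine T _ _ hT _ z

lemma bd_smithOp (p : ℕ) (g : X → X) (b : Bool) (z : List X →₀ R) :
    bd (smithOp R p g b z) = smithOp R p g b (bd z) :=
  smithOp_intertwine p bd (bd_push g) b z

lemma smithOp_mem (p : ℕ) {g : X → X} {S : Set (List X)} (hS : ∀ l ∈ S, l.map g ∈ S) (b : Bool)
    {z : List X →₀ R} (hz : z ∈ Finsupp.supported R R S) :
    smithOp R p g b z ∈ Finsupp.supported R R S :=
  aeval_mem _ (fun _ hz => push_mem hS hz) _ hz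

lemma smithOp_apply_of_fixed {p : ℕ} (hpR : (p : R) = 0) {g : X → X} (hg : Function.Injective g)
    (b : Bool) {l : List X} (hl : l.map g = l) (z : List X →₀ R) : smithOp R p g b z l = 0 := by
  cases b
  · rw [smithOp_false]; exact normOp_apply_of_fixed hpR hg.list_map hl z
  · rw [smithOp_true]; exact diffOp_apply_of_fixed hg.list_map hl z

lemma smithOp_not_smithOp {p : ℕ} {g : X → X} {S : Set (List X)}
    (hS : ∀ l ∈ S, (List.map g)^[p] l = l) (b : Bool)
    {z : List X →₀ R} (hz : z ∈ Finsupp.supported R R S) :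
    smithOp R p g (!b) (smithOp R p g b z) = 0 := by
  cases b
  · rw [Bool.not_false, smithOp_false, smithOp_true]; exact diffOp_normOp hS hz
  · rw [Bool.not_true, smithOp_false, smithOp_true]; exact normOp_diffOp hS hz

lemma exists_of_smithOp_not_eq_zero {p : ℕ} (hp : p.Prime) {g : X → X} (hg : Function.Injective g)
    {S : Set (List X)} (hS : ∀ l ∈ S, l.map g ∈ S) (hSp : ∀ l ∈ S, (List.map g)^[p] l = l)
    (b : Bool) (z : List X →₀ R) (hz : z ∈ Finsupp.supported R R S)
    (h0 : smithOp R p g (!b) z = 0) :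
    ∃ a ∈ Finsupp.supported R R S, ∃ w ∈ Finsupp.supported R R {l ∈ S | l.map g = l},
      z = smithOp R p g b a + w := by
  cases b
  · rw [smithOp_false]
    rw [Bool.not_false, smithOp_true] at h0
    exact exists_of_diffOp_eq_zero hp hg.list_map hS hSp z hz h0
  · rw [smithOp_true]
    rw [Bool.not_true, smithOp_false] at h0
    exact exists_of_normOp_eq_zero hp hg.list_map hS hSp z hz h0

lemma eq_of_smithOp_add {p : ℕ} (hpR : (p : R) = 0) {g : X → X} (hg : Function.Injective g)
    (b : Bool) {x y z : List X →₀ R} (hx : x ∈ Finsupp.supported R R {l : List X | l.map g = l})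
    (hz : z ∈ Finsupp.supported R R {l : List X | l.map g = l})
    (h : x = smithOp R p g b y + z) : x = z := by
  ext l
  by_cases hl : l.map g = l
  · simp [h, smithOp_apply_of_fixed hpR hg b hl]
  · rw [(Finsupp.mem_supported' R x).1 hx l hl, (Finsupp.mem_supported' R z).1 hz l hl]

lemma bd_mem_fixed {g : X → X} {z : List X →₀ R}
    (hz : z ∈ Finsupp.supported R R {l : List X | l.map g = l}) :
    bd z ∈ Finsupp.supported R R {l : List X | l.map g = l} := by
  refine bd_mem (fun l hl m hm _ => ?_) hz
  have h : ∀ x ∈ l, g x = x := by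
    have h' : l.map g = l.map id := by rw [List.map_id]; exact hl
    exact fun x hx => List.map_inj_left.1 h' x hx
  change m.map g = m
  conv_rhs => rw [← List.map_id m]
  exact List.map_congr_left fun x hx => h x (hm.subset hx)

variable [PseudoMetricSpace X]

/-- Up to a loss of fineness and an enlargement of `K` to `L`, cycles of the form `ρ c` with `c` a
chain of tuples of length at least `m` are boundaries of chains of the same form. -/
def Bounds (ρ : (List X →₀ R) →ₗ[R] (List X →₀ R)) (K L : Set X) (m : ℕ) : Prop :=
  ∀ ε > 0, ∃ δ > 0, ∀ n ≥ m, ∀ c ∈ Finsupp.supported R R (Small K δ n), bd (ρ c) = 0 →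
    ∃ e ∈ Finsupp.supported R R (Small L ε (n + 1)), bd (ρ e) = ρ c

/-- Up to a loss of fineness, reduced cycles in `K` are boundaries in `L`. -/
def Acyclic (R : Type) [CommRing R] (K L : Set X) : Prop :=
  Bounds (LinearMap.id : (List X →₀ R) →ₗ[R] _) K L 0

lemma Bounds.mono {ρ : (List X →₀ R) →ₗ[R] (List X →₀ R)} {K K' L L' : Set X} {m m' : ℕ}
    (h : Bounds ρ K L m) (hK : K' ⊆ K) (hL : L ⊆ L') (hm : m ≤ m') : Bounds ρ K' L' m' := by
  intro ε hε
  obtain ⟨δ, hδ, H⟩ := h ε hε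
  refine ⟨δ, hδ, fun n hn c hc h0 => ?_⟩
  obtain ⟨e, he, h⟩ := H n (hm.trans hn) c (Finsupp.supported_mono (Small.mono hK le_rfl n) hc) h0
  exact ⟨e, Finsupp.supported_mono (Small.mono hL le_rfl _) he, h⟩

lemma Acyclic.mono {K K' L L' : Set X} (h : Acyclic R K L) (hK : K' ⊆ K) (hL : L ⊆ L') :
    Acyclic R K' L' :=
  Bounds.mono h hK hL le_rfl

lemma iterate_map_eq_self {p : ℕ} {g : X → X} {L : Set X} (hgp : ∀ x ∈ L, g^[p] x = x) {ε : ℝ}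
    {n : ℕ} : ∀ l ∈ Small L ε n, (List.map g)^[p] l = l := by
  intro l hl
  have hmap : ∀ (i : ℕ) (m : List X), (List.map g)^[i] m = m.map g^[i] := by
    intro i
    induction i with
    | zero => simp
    | succ i ih => intro m; rw [Function.iterate_succ_apply, ih, List.map_map]; rfl
  rw [hmap]
  conv_rhs => rw [← List.map_id l]
  exact List.map_congr_left fun x hx => hgp x (hl.2 x hx).1

lemma exists_smith_bounds {p : ℕ} (hp : p.Prime) {g : X → X}
    (hg : Function.Injective g) (hgi : Isometry g) {L : Set X} (hgL : MapsTo g L L)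
    (hgp : ∀ x ∈ L, g^[p] x = x) (b : Bool) {K' : Set X} (hK'L : K' ⊆ L)
    {m : ℕ} (hB : Bounds (smithOp R p g (!b)) K' L (m + 1)) {ε : ℝ} (hε : 0 < ε) :
    ∃ δ > 0, ∀ n ≥ m, ∀ c ∈ Finsupp.supported R R (Small K' δ (n + 1)),
      smithOp R p g (!b) (bd c) = 0 →
      ∃ a ∈ Finsupp.supported R R (Small L ε (n + 1)),
      ∃ w ∈ Finsupp.supported R R {l ∈ Small L ε (n + 1) | l.map g = l},
        bd c = smithOp R p g b (bd a) + bd w := by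
  obtain ⟨δ, hδ, H⟩ := hB ε hε
  refine ⟨min δ ε, lt_min hδ hε, fun n hn c hc h0 => ?_⟩
  obtain ⟨e, he, hce⟩ := H (n + 1) (by omega) c
    (Finsupp.supported_mono (Small.mono le_rfl (min_le_left _ _) _) hc) (by rw [bd_smithOp, h0])
  rw [bd_smithOp] at hce
  obtain ⟨a, ha, w, hw, h⟩ := exists_of_smithOp_not_eq_zero hp hg (Small.map hgi hgL)
    (iterate_map_eq_self hgp) b (c - bd e) (Submodule.sub_mem _
      (Finsupp.supported_mono (Small.mono hK'L (min_le_right _ _) _) hc)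
      (bd_mem (Small.face (n + 1)) he)) (by rw [map_sub, hce, sub_self])
  refine ⟨a, ha, w, hw, ?_⟩
  rw [← bd_smithOp, ← map_add, ← h, map_sub, bd_bd, sub_zero]

lemma Bounds.step {p : ℕ} (hp : p.Prime) (hpR : (p : R) = 0) {g : X → X}
    (hg : Function.Injective g) (hgi : Isometry g) {K K' L : Set X} (hgK : MapsTo g K K)
    (hKL : K ⊆ L) (hgL : MapsTo g L L)
    (hgp : ∀ x ∈ L, g^[p] x = x) (b : Bool) (hA : Acyclic R K K') (hK'L : K' ⊆ L)
    {m : ℕ} (hB : Bounds (smithOp R p g (!b)) K' L (m + 1)) : Bounds (smithOp R p g b) K L m := by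
  intro ε hε
  obtain ⟨δ, hδ, H⟩ := exists_smith_bounds hp hg hgi hgL hgp b hK'L hB hε
  obtain ⟨δ', hδ', H'⟩ := hA δ hδ
  refine ⟨δ', hδ', fun n hn c hc h0 => ?_⟩
  obtain ⟨y, hy, hyc⟩ := H' n n.zero_le (smithOp R p g b c)
    (smithOp_mem p (Small.map hgi hgK) b hc) h0
  simp only [LinearMap.id_apply] at hyc
  obtain ⟨a, ha, w, hw, h⟩ := H n hn y hy (by
    rw [hyc]
    exact smithOp_not_smithOp (iterate_map_eq_self fun x hx => hgp x (hKL hx)) b hc)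
  refine ⟨a, ha, ?_⟩
  have hw' := bd_mem_fixed (Finsupp.supported_mono (fun l hl => hl.2) hw)
  have h1 : bd w = 0 := by
    refine (eq_of_smithOp_add hpR hg b (y := c - bd a) (Submodule.zero_mem _)
      (Submodule.neg_mem _ hw') ?_ |>.symm |> neg_eq_zero.1)
    rw [map_sub, ← hyc, h]
    abel
  rw [bd_smithOp, ← hyc, h, h1, add_zero]

lemma Acyclic.fixed {p : ℕ} (hp : p.Prime) (hpR : (p : R) = 0) {g : X → X}
    (hg : Function.Injective g) (hgi : Isometry g) {K K' L : Set X} (hgL : MapsTo g L L)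
    (hgp : ∀ x ∈ L, g^[p] x = x) (hA : Acyclic R K K') (hK'L : K' ⊆ L)
    (hB : Bounds (smithOp R p g true) K' L 0) :
    Acyclic R (K ∩ {x | g x = x}) (L ∩ {x | g x = x}) := by
  intro ε hε
  have hlist : ∀ l : List X, (∀ x ∈ l, g x = x) ↔ l.map g = l := by
    intro l
    conv_rhs => rhs; rw [← List.map_id l]
    exact List.map_inj_left.symm
  obtain ⟨δ, hδ, H⟩ := exists_smith_bounds hp hg hgi hgL hgp false hK'L
    (hB.mono le_rfl le_rfl (Nat.zero_le (0 + 1))) hε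
  obtain ⟨δ', hδ', H'⟩ := hA δ hδ
  refine ⟨δ', hδ', fun n hn z hz h0 => ?_⟩
  have hzfix : z ∈ Finsupp.supported R R {l : List X | l.map g = l} :=
    Finsupp.supported_mono (fun l hl => (hlist l).1 fun x hx => (hl.2 x hx).1.2) hz
  obtain ⟨y, hy, hyz⟩ := H' n n.zero_le z
    (Finsupp.supported_mono (Small.mono inter_subset_left le_rfl _) hz) h0
  simp only [LinearMap.id_apply] at hyz ⊢
  obtain ⟨a, ha, w, hw, h⟩ := H n n.zero_le y hy (by
    rw [hyz, Bool.not_false, smithOp_true, diffOp_apply, sub_eq_zero]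
    conv_lhs => rw [← Finsupp.mapDomain_id (v := z)]
    exact (Finsupp.mapDomain_congr fun l hl => ((Finsupp.mem_supported R z).1 hzfix hl)).symm)
  have hw' := bd_mem_fixed (Finsupp.supported_mono (fun l hl => hl.2) hw)
  refine ⟨w, Finsupp.supported_mono ?_ hw, ?_⟩
  · rintro l ⟨hl, hlg⟩
    exact ⟨hl.1, fun x hx => ⟨⟨(hl.2 x hx).1, (hlist l).2 hlg x hx⟩, (hl.2 x hx).2⟩⟩
  · exact (eq_of_smithOp_add hpR hg false hzfix hw' (hyz.symm.trans h)).symm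

end Smith

section Tower

variable {R X : Type} [CommRing R] [MetricSpace X]

lemma coverOrderLE_univ_subtype {K : Set X} {D : ℕ} (hD : CoverOrderLE K D) :
    CoverOrderLE (univ : Set K) D := by
  intro ι _ U hU hc
  choose U' hU' hUU' using fun i => isOpen_induced_iff.1 (hU i)
  obtain ⟨W, hW, hWU, hWc, hWD⟩ := hD ι U' hU' (by
    intro x hx
    obtain ⟨i, hi⟩ := mem_iUnion.1 (hc (mem_univ (⟨x, hx⟩ : K)))
    rw [← hUU' i] at hi
    exact mem_iUnion.2 ⟨i, hi⟩)
  refine ⟨fun i => Subtype.val ⁻¹' W i, fun i => (hW i).preimage continuous_subtype_val, ?_, ?_,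
    fun x _ => hWD x x.2⟩
  · intro i
    rw [← hUU' i]
    exact preimage_mono (hWU i)
  · intro x _
    obtain ⟨i, hi⟩ := mem_iUnion.1 (hWc x.2)
    exact mem_iUnion.2 ⟨i, hi⟩

lemma exists_push_val {K : Set X} {δ : ℝ} {n : ℕ} {c : List X →₀ R}
    (hc : c ∈ Finsupp.supported R R (Small K δ n)) :
    ∃ c' ∈ Finsupp.supported R R (Small (univ : Set K) δ n), push Subtype.val c' = c := by
  have hc' : c ∈ (Finsupp.supported R R (Small (univ : Set K) δ n)).map (push Subtype.val) := by
    refine map_mem_of_supported LinearMap.id (fun l hl => ?_) hc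
    obtain ⟨l', rfl⟩ : ∃ l' : List K, l'.map Subtype.val = l :=
      ⟨l.attach.map fun x => ⟨x.1, (hl.2 x.1 x.2).1⟩, by simp⟩
    refine ⟨Finsupp.single l' 1, Finsupp.single_mem_supported R _ ⟨by simpa using hl.1,
      fun x hx => ⟨mem_univ _, fun y hy => ?_⟩⟩, by simp⟩
    exact (hl.2 x (List.mem_map_of_mem hx)).2 y (List.mem_map_of_mem hy)
  obtain ⟨c', h, h'⟩ := hc'
  exact ⟨c', h, h'⟩

lemma Bounds.of_coverOrderLE {p : ℕ} (hp : 0 < p) {g : X → X} (hg : Isometry g) {K : Set X}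
    (hK : IsCompact K) (hgK : MapsTo g K K) (hgp : ∀ x ∈ K, g^[p] x = x) {D : ℕ}
    (hD : CoverOrderLE K D) (b : Bool) : Bounds (smithOp R p g b) K K (p * D + 1) := by
  intro ε hε
  have := isCompact_iff_compactSpace.1 hK
  let g' : K → K := hgK.restrict g K K
  have hg' : Isometry g' := fun x y => hg x y
  have hgp' : ∀ x, g'^[p] x = x := by
    intro x
    refine Subtype.ext ?_
    rw [hgK.iterate_restrict]
    exact hgp x x.2
  have hval : ∀ z : List K →₀ R, push Subtype.val (push g' z) = push g (push Subtype.val z) := by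
    intro z
    have : (push Subtype.val ∘ₗ push g' : (List K →₀ R) →ₗ[R] _) = push g ∘ₗ push Subtype.val :=
      linearMap_ext fun l => by
        simp only [LinearMap.comp_apply, push_single, List.map_map]
        rfl
    exact LinearMap.congr_fun this z
  have hinj : Function.Injective (push Subtype.val : (List K →₀ R) →ₗ[R] (List X →₀ R)) :=
    Finsupp.mapDomain_injective Subtype.val_injective.list_map
  obtain ⟨δ, hδ, H, hHg, hHbd, hHs⟩ :=
    exists_equivariant_homotopy R hg' hp hgp' (coverOrderLE_univ_subtype hD) hε
  refine ⟨δ, hδ, fun n hn c hc h0 => ?_⟩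
  obtain ⟨c, hc', rfl⟩ := exists_push_val hc
  rw [← smithOp_intertwine p _ hval, bd_push] at h0
  have h0' := hinj (h0.trans (map_zero _).symm)
  obtain ⟨n, rfl⟩ : ∃ k, n = k + 1 := ⟨n - 1, by omega⟩
  refine ⟨push Subtype.val (H (n + 1) c), push_mem (Small.map isometry_subtype_coe ?_)
    (hHs _ _ hc'), ?_⟩
  · exact fun x _ => x.2
  · have h := hHbd n (by omega) (smithOp R p g' b c)
      (smithOp_mem p (Small.map hg' (mapsTo_univ _ _)) b hc')
    rw [h0', map_zero, add_zero, smithOp_intertwine p _ (hHg _)] at h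
    rw [← smithOp_intertwine p _ hval, bd_push, h, smithOp_intertwine p _ hval]

/-- Smith theory: a tower of successively acyclic compact invariant sets yields acyclicity of the
fixed points of the bottom in those of the top. -/
lemma Acyclic.fixed_of_tower {p : ℕ} (hp : p.Prime) (hpR : (p : R) = 0) {g : X → X}
    (hg : Isometry g) {D : ℕ} (K : ℕ → Set X) (hKm : Monotone K) (hKc : ∀ i, IsCompact (K i))
    (hgK : ∀ i, MapsTo g (K i) (K i)) (hgp : ∀ i, ∀ x ∈ K i, g^[p] x = x)
    (hD : ∀ i, CoverOrderLE (K i) D) (hA : ∀ i ≤ p * D + 1, Acyclic R (K i) (K (i + 1))) :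
    Acyclic R (K 0 ∩ {x | g x = x}) (K (p * D + 2) ∩ {x | g x = x}) := by
  have key : ∀ i ≤ p * D + 1, ∀ b,
      Bounds (smithOp R p g b) (K (i + 1)) (K (p * D + 2)) i := by
    intro i hi
    induction hi using Nat.decreasingInduction with
    | self =>
      intro b
      exact Bounds.of_coverOrderLE hp.pos hg (hKc _) (hgK _) (hgp _) (hD _) b
    | of_succ i hi ih =>
      intro b
      exact Bounds.step hp hpR hg.injective hg (hgK _) (hKm (by omega)) (hgK _) (hgp _) b
        (hA (i + 1) (by omega)) (hKm (by omega)) (ih _)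
  exact Acyclic.fixed hp hpR hg.injective hg (hgK _) (hgp _) (hA 0 (by omega)) (hKm (by omega))
    (key 0 (by omega) true)

end Tower

section AcyclicSet

variable {R X : Type} [CommRing R] [MetricSpace X]

/-- A closed set whose compact subsets are acyclic in larger compact subsets, both globally and
locally. -/
structure AcyclicSet (R : Type) [CommRing R] (A : Set X) : Prop where
  isClosed : IsClosed A
  exists_superset : ∀ K ⊆ A, IsCompact K → ∃ L ⊆ A, IsCompact L ∧ K ⊆ L ∧ Acyclic R K L
  exists_closedBall : ∀ x ∈ A, ∀ r > 0, ∃ s > 0, s ≤ r ∧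
    Acyclic R (A ∩ closedBall x s) (A ∩ closedBall x r)

lemma AcyclicSet.exists_invariant_superset {A : Set X} (hA : AcyclicSet R A) {p : ℕ} (hp : 0 < p)
    {g : X → X} (hg : Isometry g) (hgA : MapsTo g A A) (hgp : ∀ x ∈ A, g^[p] x = x) {K : Set X}
    (hKA : K ⊆ A) (hK : IsCompact K) :
    ∃ L ⊆ A, IsCompact L ∧ MapsTo g L L ∧ K ⊆ L ∧ Acyclic R K L := by
  obtain ⟨L, hLA, hL, hKL, hac⟩ := hA.exists_superset K hKA hK
  have hsub : L ⊆ ⋃ i ∈ Finset.range p, g^[i] '' L := fun x hx =>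
    mem_iUnion₂.2 ⟨0, Finset.mem_range.2 hp, x, hx, rfl⟩
  refine ⟨⋃ i ∈ Finset.range p, g^[i] '' L, ?_, ?_, ?_, hKL.trans hsub,
    hac.mono Subset.rfl hsub⟩
  · refine iUnion₂_subset fun i _ => ?_
    rintro _ ⟨x, hx, rfl⟩
    exact hgA.iterate i (hLA hx)
  · exact (Finset.range p).isCompact_biUnion fun i _ => hL.image (isometry_iterate hg i).continuous
  · intro y hy
    obtain ⟨i, hi, x, hx, rfl⟩ := mem_iUnion₂.1 hy
    rw [← Function.iterate_succ_apply' g]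
    have hi' := Finset.mem_range.1 hi
    rcases eq_or_lt_of_le (Nat.succ_le_of_lt hi') with h | h
    · rw [h, hgp x (hLA hx)]
      exact hsub hx
    · exact mem_iUnion₂.2 ⟨i + 1, Finset.mem_range.2 h, x, hx, rfl⟩

lemma AcyclicSet.inter_fixed [LocallyCompactSpace X] {A : Set X} (hA : AcyclicSet R A) {p : ℕ}
    (hp : p.Prime) (hpR : (p : R) = 0) {g : X → X} (hg : Isometry g) (hgA : MapsTo g A A)
    (hgp : ∀ x ∈ A, g^[p] x = x) {D : ℕ} (hD : ∀ K : Set X, IsCompact K → CoverOrderLE K D) :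
    AcyclicSet R (A ∩ {x | g x = x}) := by
  have hF : IsClosed {x | g x = x} := isClosed_eq hg.continuous continuous_id
  refine ⟨hA.isClosed.inter hF, fun K hKA hK => ?_, ?_⟩
  · let P := {K : Set X // K ⊆ A ∧ IsCompact K ∧ MapsTo g K K}
    have hnext : ∀ K : P, ∃ L : P, K.1 ⊆ L.1 ∧ Acyclic R K.1 L.1 := by
      rintro ⟨K, hKA, hK, -⟩
      obtain ⟨L, h1, h2, h3, h4, h5⟩ :=
        hA.exists_invariant_superset hp.pos hg hgA hgp hKA hK
      exact ⟨⟨L, h1, h2, h3⟩, h4, h5⟩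
    choose next hnext1 hnext2 using hnext
    have hKg : MapsTo g K K := by
      intro x hx
      have : g x = x := (hKA hx).2
      rwa [this]
    let S : ℕ → P := fun n => next^[n] ⟨K, hKA.trans inter_subset_left, hK, hKg⟩
    have hS : ∀ n, S (n + 1) = next (S n) := fun n => Function.iterate_succ_apply' _ _ _
    have h := Acyclic.fixed_of_tower (R := R) hp hpR hg (D := D) (fun i => (S i).1)
      (monotone_nat_of_le_succ fun n => by simpa only [hS] using hnext1 (S n))
      (fun i => (S i).2.2.1) (fun i => (S i).2.2.2) (fun i x hx => hgp x ((S i).2.1 hx))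
      (fun i => hD _ (S i).2.2.1) (fun i _ => by simpa only [hS] using hnext2 (S i))
    have hsub : K ⊆ (S (p * D + 2)).1 ∩ {x | g x = x} := by
      intro x hx
      refine ⟨?_, (hKA hx).2⟩
      exact (monotone_nat_of_le_succ (f := fun n => (S n).1)
        fun n => by simpa only [hS] using hnext1 (S n)) (Nat.zero_le (p * D + 2)) hx
    refine ⟨(S (p * D + 2)).1 ∩ {x | g x = x}, inter_subset_inter_left _ (S _).2.1,
      (S _).2.2.1.inter_right hF, hsub, h.mono ?_ Subset.rfl⟩
    exact fun x hx => ⟨hx, (hKA hx).2⟩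
  · rintro x ⟨hxA, hxg⟩ r hr
    obtain ⟨r₀, hr₀, hcpt⟩ := exists_isCompact_closedBall x
    choose! f hf0 hfle hf using hA.exists_closedBall x hxA
    let s : ℕ → ℝ := fun n => f^[n] (min r r₀)
    have hs : ∀ n, s (n + 1) = f (s n) := fun n => Function.iterate_succ_apply' _ _ _
    have hs0 : ∀ n, 0 < s n := by
      intro n
      induction n with
      | zero => exact lt_min hr hr₀
      | succ n ih => rw [hs]; exact hf0 _ ih
    have hsa : Antitone s := antitone_nat_of_succ_le fun n => by rw [hs]; exact hfle _ (hs0 n)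
    have hsr : ∀ n, s n ≤ min r r₀ := fun n => hsa n.zero_le
    have h := Acyclic.fixed_of_tower (R := R) hp hpR hg (D := D)
      (fun i => A ∩ closedBall x (s (p * D + 2 - i)))
      (fun i j hij => inter_subset_inter_right _ (closedBall_subset_closedBall (hsa (by omega))))
      (fun i => (hcpt.of_isClosed_subset isClosed_closedBall (closedBall_subset_closedBall
        ((hsr _).trans (min_le_right _ _)))).inter_left hA.isClosed)
      (fun i y hy => ⟨hgA hy.1, by
        have hxg' : g x = x := hxg
        have := hy.2
        rwa [mem_closedBall, ← hg.dist_eq, hxg'] at this⟩)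
      (fun i y hy => hgp y hy.1)
      (fun i => hD _ ((hcpt.of_isClosed_subset isClosed_closedBall (closedBall_subset_closedBall
        ((hsr _).trans (min_le_right _ _)))).inter_left hA.isClosed))
      (fun i hi => by
        have : p * D + 2 - i = p * D + 2 - (i + 1) + 1 := by omega
        rw [this, hs]
        exact hf _ (hs0 _))
    refine ⟨s (p * D + 2), hs0 _, (hsr _).trans (min_le_left _ _), h.mono ?_ ?_⟩
    · exact fun y hy => ⟨⟨hy.1.1, hy.2⟩, hy.1.2⟩
    · exact fun y hy => ⟨⟨hy.1.1, hy.2⟩, closedBall_subset_closedBall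
        ((hsr _).trans (min_le_left _ _)) hy.1.2⟩

end AcyclicSet

section Contraction

variable {R X : Type} [CommRing R] [MetricSpace X]

lemma exists_bd_eq_push_sub {f g : X → X} {K L : Set X} {δ ε : ℝ}
    (hK : ∀ x ∈ K, f x ∈ L ∧ g x ∈ L)
    (hfg : ∀ x ∈ K, ∀ y ∈ K, dist x y < δ → dist (f x) (f y) < ε ∧ dist (f x) (g y) < ε ∧
      dist (g x) (g y) < ε) (n : ℕ) {z : List X →₀ R}
    (hz : z ∈ Finsupp.supported R R (Small K δ (n + 1))) (h0 : bd z = 0) :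
    ∃ c ∈ Finsupp.supported R R (Small L ε (n + 2)), bd c = push g z - push f z := by
  obtain ⟨A, hA⟩ : ∃ A : ℕ → (List X →₀ R) →ₗ[R] (List X →₀ R),
      ∀ n z, A n z = push g z - push f z := ⟨fun _ => push g - push f, fun _ _ => rfl⟩
  refine ⟨homotopyOp f A (n + 1) z, ?_, ?_⟩
  · refine map_mem_of_supported _ (fun l hl => ?_) hz
    refine Finsupp.supported_mono ?_ (homotopyOp_mem f A (fun x y => y = f x ∨ y = g x)
      (fun _ => Or.inl rfl) (Small K δ) (fun _ _ h => h.1) Small.face (fun n l hl => ?_) _ l hl)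
    · rintro m ⟨h1, h2⟩
      refine ⟨h1, fun y hy => ?_⟩
      obtain ⟨x, hx, hxy⟩ := h2 y hy
      refine ⟨by rcases hxy with rfl | rfl; exacts [(hK x (hl.2 x hx).1).1, (hK x (hl.2 x hx).1).2],
        fun y' hy' => ?_⟩
      obtain ⟨x', hx', hxy'⟩ := h2 y' hy'
      have h3 := hfg x (hl.2 x hx).1 x' (hl.2 x' hx').1 ((hl.2 x hx).2 x' hx')
      have h4 := hfg x' (hl.2 x' hx').1 x (hl.2 x hx).1 ((hl.2 x' hx').2 x hx)
      rcases hxy with rfl | rfl <;> rcases hxy' with rfl | rfl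
      · exact h3.1
      · exact h3.2.1
      · rw [dist_comm]; exact h4.2.1
      · exact h3.2.2
    · rw [hA, push_single, push_single]
      refine Submodule.sub_mem _ (Finsupp.single_mem_supported R _ ?_)
        (Finsupp.single_mem_supported R _ ?_)
      all_goals
        refine ⟨by simpa using hl.1, fun y hy => ?_⟩
        obtain ⟨x, hx, rfl⟩ := List.mem_map.1 hy
      · exact ⟨x, hx, Or.inr rfl⟩
      · exact ⟨x, hx, Or.inl rfl⟩
  · have h := bd_homotopyOp f A (Small K δ) (fun _ _ h => h.1) Small.face (fun l hl => by
      rw [List.length_eq_zero_iff.1 hl.1, hA]; simp)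
      (fun n l _ => by rw [hA, hA, map_sub, bd_push, bd_push]) n hz
    rwa [h0, map_zero, add_zero, hA] at h

lemma Acyclic.of_contraction {K L : Set X} (hK : IsCompact K) (H : ℝ → X → X)
    (hH : ContinuousOn (Function.uncurry H) (Icc 0 1 ×ˢ K)) (h0 : ∀ x ∈ K, H 0 x = x) {c : X}
    (hc : c ∈ L) (h1 : ∀ x ∈ K, H 1 x = c) (hL : ∀ t ∈ Icc (0 : ℝ) 1, ∀ x ∈ K, H t x ∈ L) :
    Acyclic R K L := by
  intro ε hε
  obtain ⟨δ, hδ, hu⟩ := Metric.uniformContinuousOn_iff.1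
    ((isCompact_Icc.prod hK).uniformContinuousOn_of_continuous hH) ε hε
  obtain ⟨N, hN⟩ := exists_nat_one_div_lt hδ
  have hclose : ∀ s ∈ Icc (0 : ℝ) 1, ∀ t ∈ Icc (0 : ℝ) 1, dist s t < δ → ∀ x ∈ K, ∀ y ∈ K,
      dist x y < δ → dist (H s x) (H t y) < ε := by
    intro s hs t ht hst x hx y hy hxy
    exact hu (s, x) ⟨hs, hx⟩ (t, y) ⟨ht, hy⟩ (by rw [Prod.dist_eq]; exact max_lt hst hxy)
  refine ⟨δ, hδ, fun n _ z hz hz0 => ?_⟩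
  simp only [LinearMap.id_apply] at hz0 ⊢
  cases n with
  | zero =>
    refine ⟨cone c z, cone_mem (fun l hl => ?_) hz, by rw [bd_cone, hz0, map_zero, sub_zero]⟩
    rw [List.length_eq_zero_iff.1 hl.1]
    exact ⟨rfl, by simp [hc, hε]⟩
  | succ n =>
    have hNpos : (0 : ℝ) < N + 1 := by positivity
    have hmem : ∀ i ≤ N + 1, ((i : ℝ) / (N + 1)) ∈ Icc (0 : ℝ) 1 := by
      intro i hi
      refine ⟨by positivity, (div_le_one hNpos).2 ?_⟩
      exact_mod_cast hi
    have hstep : ∀ i < N + 1, ∃ d ∈ Finsupp.supported R R (Small L ε (n + 2)),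
        bd d = push (H ((i + 1 : ℕ) / (N + 1))) z - push (H (i / (N + 1))) z := by
      intro i hi
      refine exists_bd_eq_push_sub (fun x hx => ⟨hL _ (hmem i hi.le) x hx,
        hL _ (hmem (i + 1) hi) x hx⟩) (fun x hx y hy hxy => ?_) n hz hz0
      refine ⟨hclose _ (hmem i hi.le) _ (hmem i hi.le) (by simpa) x hx y hy hxy,
        hclose _ (hmem i hi.le) _ (hmem (i + 1) hi) ?_ x hx y hy hxy,
        hclose _ (hmem (i + 1) hi) _ (hmem (i + 1) hi) (by simpa) x hx y hy hxy⟩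
      rw [Real.dist_eq, ← sub_div, abs_div, abs_of_pos hNpos]
      simpa using hN
    choose! d hd hbd using hstep
    have hsum : bd (∑ i ∈ Finset.range (N + 1), d i) = push (H 1) z - push (H 0) z := by
      rw [map_sum, Finset.sum_congr rfl fun i hi => hbd i (Finset.mem_range.1 hi),
        Finset.sum_range_sub (fun i : ℕ => push (R := R) (H (i / (N + 1))) z)]
      have : ((N + 1 : ℕ) : ℝ) / (N + 1) = 1 := by
        push_cast
        exact div_self hNpos.ne'
      rw [this]
      simp
    have hid : push (H 0) z = z := by
      refine map_eq_of_supported (push (H 0)) LinearMap.id (fun l hl => ?_) hz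
      rw [push_single, LinearMap.id_apply]
      conv_rhs => rw [← List.map_id l]
      rw [List.map_congr_left fun x hx => h0 x (hl.2 x hx).1]
      rfl
    refine ⟨cone c (push (H 1) z) - ∑ i ∈ Finset.range (N + 1), d i, Submodule.sub_mem _
      (cone_mem (S := Small {c} ε (n + 1)) ?_ (push_mem ?_ hz))
      (Submodule.sum_mem _ fun i hi => hd i (Finset.mem_range.1 hi)), ?_⟩
    · rintro l ⟨hl1, hl2⟩
      have hall : ∀ x ∈ c :: l, x = c := by
        intro x hx
        rcases List.mem_cons.1 hx with h | h
        exacts [h, (hl2 x h).1]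
      refine ⟨by simp [hl1], fun x hx => ?_⟩
      rw [hall x hx]
      refine ⟨hc, fun y hy => ?_⟩
      rw [hall y hy]
      simpa
    · rintro l ⟨hl1, hl2⟩
      have hall : ∀ x ∈ l.map (H 1), x = c := by
        intro x hx
        obtain ⟨y, hy, rfl⟩ := List.mem_map.1 hx
        exact h1 y (hl2 y hy).1
      refine ⟨by simpa using hl1, fun x hx => ?_⟩
      rw [hall x hx]
      refine ⟨rfl, fun y hy => ?_⟩
      rw [hall y hy]
      simpa
    · rw [map_sub, hsum, bd_cone, bd_push, hz0, hid]
      simp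

lemma acyclicSet_univ (R : Type) [CommRing R] [LocallyCompactSpace X] [ContractibleSpace X]
    (hch : ∀ x : X, ∃ (n : ℕ) (e : OpenPartialHomeomorph X (Fin n → ℝ)), x ∈ e.source) :
    AcyclicSet R (univ : Set X) where
  isClosed := isClosed_univ
  exists_superset := by
    intro K _ hK
    obtain ⟨c, ⟨F⟩⟩ := id_nullhomotopic X
    let H : ℝ → X → X := fun t x => F (projIcc 0 1 zero_le_one t, x)
    have hH : Continuous (Function.uncurry H) :=
      F.continuous.comp ((continuous_projIcc.comp continuous_fst).prodMk continuous_snd)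
    refine ⟨Function.uncurry H '' (Icc 0 1 ×ˢ K) ∪ insert c K, subset_univ _,
      ((isCompact_Icc.prod hK).image hH).union (hK.insert c),
      fun x hx => Or.inr (Or.inr hx), Acyclic.of_contraction hK H hH.continuousOn
        (fun x _ => ?_) (c := c) (Or.inr (Or.inl rfl)) (fun x _ => ?_)
        fun t ht x hx => Or.inl ⟨(t, x), ⟨ht, hx⟩, rfl⟩⟩
    · simp [H]
    · simp [H]
  exists_closedBall := by
    intro x _ r hr
    obtain ⟨n, e, hx⟩ := hch x
    obtain ⟨r₀, hr₀, hcpt⟩ := exists_isCompact_closedBall x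
    have hsymm : e.target ∩ e.symm ⁻¹' closedBall x r ∈ 𝓝 (e x) := by
      refine inter_mem (e.open_target.mem_nhds (e.map_source hx))
        ((e.continuousAt_symm (e.map_source hx)).preimage_mem_nhds ?_)
      rw [e.left_inv hx]
      exact closedBall_mem_nhds x hr
    obtain ⟨ρ, hρ, hρs⟩ := nhds_basis_closedBall.mem_iff.1 hsymm
    have hfwd : e.source ∩ e ⁻¹' closedBall (e x) ρ ∈ 𝓝 x :=
      inter_mem (e.open_source.mem_nhds hx)
        ((e.continuousAt hx).preimage_mem_nhds (closedBall_mem_nhds _ hρ))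
    obtain ⟨s, hs, hss⟩ := nhds_basis_closedBall.mem_iff.1 hfwd
    let s' := min s (min r r₀)
    have hs' : closedBall x s' ⊆ e.source ∩ e ⁻¹' closedBall (e x) ρ :=
      (closedBall_subset_closedBall (min_le_left _ _)).trans hss
    have hmem : ∀ t ∈ Icc (0 : ℝ) 1, ∀ z ∈ closedBall x s',
        e x + (1 - t) • (e z - e x) ∈ closedBall (e x) ρ := by
      intro t ht z hz
      have hz' : ‖e z - e x‖ ≤ ρ := by rw [← dist_eq_norm]; exact (hs' hz).2
      rw [mem_closedBall, dist_eq_norm, add_sub_cancel_left, norm_smul,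
        Real.norm_of_nonneg (by linarith [ht.2])]
      calc (1 - t) * ‖e z - e x‖ ≤ 1 * ‖e z - e x‖ := by gcongr; linarith [ht.1]
        _ ≤ ρ := by rwa [one_mul]
    refine ⟨s', lt_min hs (lt_min hr hr₀), (min_le_right _ _).trans (min_le_left _ _), ?_⟩
    rw [univ_inter, univ_inter]
    refine Acyclic.of_contraction (hcpt.of_isClosed_subset isClosed_closedBall
      (closedBall_subset_closedBall ((min_le_right _ _).trans (min_le_right _ _))))
      (fun t z => e.symm (e x + (1 - t) • (e z - e x))) ?_ (fun z hz => ?_) (c := x)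
      (mem_closedBall_self hr.le) (fun z hz => ?_) fun t ht z hz => (hρs (hmem t ht z hz)).2
    · refine e.continuousOn_symm.comp ?_ fun q hq => (hρs (hmem q.1 hq.1 q.2 hq.2)).1
      have h1 : ContinuousOn (fun q : ℝ × X => e q.2) (Icc 0 1 ×ˢ closedBall x s') :=
        e.continuousOn.comp continuousOn_snd fun q hq => (hs' hq.2).1
      exact continuousOn_const.add ((continuousOn_const.sub continuousOn_fst).smul
        (h1.sub continuousOn_const))
    · simp [e.left_inv (hs' hz).1]
    · simp [e.left_inv hx]

end Contraction

end TupleChain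

section Chains

variable {X : Type} [MetricSpace X]

/-- Two points are linked in `S` at scale `ε` if they are joined by a finite sequence of points of
`S` with steps shorter than `ε`. -/
def Linked (S : Set X) (ε : ℝ) : X → X → Prop :=
  Relation.ReflTransGen fun a b => a ∈ S ∧ b ∈ S ∧ dist a b < ε

lemma Linked.mono {S T : Set X} (h : S ⊆ T) {ε : ℝ} {x y : X} (hxy : Linked S ε x y) :
    Linked T ε x y :=
  Relation.ReflTransGen.mono (r := fun a b => a ∈ S ∧ b ∈ S ∧ dist a b < ε)
    (fun _ _ h' => ⟨h h'.1, h h'.2.1, h'.2.2⟩) x y hxy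

lemma Linked.exists_seq {S : Set X} {ε : ℝ} (hε : 0 < ε) {x y : X} (hx : x ∈ S)
    (h : Linked S ε x y) : ∃ (m : ℕ) (d : ℕ → X), d 0 = x ∧ (∀ k ≥ m, d k = y) ∧
      (∀ k, d k ∈ S) ∧ ∀ k, dist (d k) (d (k + 1)) < ε := by
  induction h with
  | refl => exact ⟨0, fun _ => x, rfl, fun _ _ => rfl, fun _ => hx, fun _ => by simpa⟩
  | @tail b c _ hbc ih =>
    obtain ⟨m, d, h0, hm, hS, hd⟩ := ih
    refine ⟨m + 1, fun k => if k ≤ m then d k else c, by simp [h0], fun k hk => ?_, fun k => ?_,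
      fun k => ?_⟩
    · exact if_neg (by omega)
    · dsimp only
      split_ifs
      exacts [hS k, hbc.2.1]
    · rcases lt_trichotomy k m with h | rfl | h
      · simp only [if_pos h.le, if_pos (Nat.succ_le_of_lt h)]
        exact hd k
      · simp only [le_refl, if_true, if_neg (Nat.not_succ_le_self k)]
        rw [hm k le_rfl]
        exact hbc.2.2
      · simp only [if_neg (not_le.2 h), if_neg (not_le.2 (h.trans k.lt_succ_self))]
        simpa

lemma dist_floor_lt {d : ℕ → X} {ε : ℝ} (hd : ∀ k, dist (d k) (d (k + 1)) < ε)
    (hε : 0 < ε) {N : ℕ} (hN : 0 < N) (s t : ℝ) (hst : dist s t < 1 / N) :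
    dist (d ⌊s * N⌋₊) (d ⌊t * N⌋₊) < ε := by
  wlog hle : s ≤ t generalizing s t
  · rw [dist_comm]
    exact this t s (by rwa [dist_comm]) (le_of_not_ge hle)
  have hN' : (0 : ℝ) < N := by exact_mod_cast hN
  have h1 : ⌊s * N⌋₊ ≤ ⌊t * N⌋₊ := Nat.floor_le_floor (by gcongr)
  have h2 : ⌊t * N⌋₊ ≤ ⌊s * N⌋₊ + 1 := by
    rcases lt_or_ge s 0 with hs | hs
    · rw [dist_comm, Real.dist_eq, abs_of_nonneg (by linarith), lt_div_iff₀ hN'] at hst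
      refine Nat.le_add_left_of_le (Nat.floor_le_of_le ?_)
      push_cast
      nlinarith
    · rw [dist_comm, Real.dist_eq, abs_of_nonneg (by linarith), lt_div_iff₀ hN'] at hst
      rw [← Nat.floor_add_one (by positivity)]
      exact Nat.floor_le_floor (by linarith)
  rcases Nat.le_succ_iff_eq_or_le.1 h2 with h | h
  · rw [h]; exact hd _
  · rw [le_antisymm h h1]; simpa

/-- A function that is continuous up to an error `ε` and runs in `S` from `x` to `y`. -/
def AlmostPath (S : Set X) (ε : ℝ) (x y : X) (f : ℝ → X) : Prop :=
  (∀ t, f t ∈ S) ∧ (∀ t ≤ 0, f t = x) ∧ (∀ t ≥ 1, f t = y) ∧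
    ∃ η > 0, ∀ s t, dist s t < η → dist (f s) (f t) < ε

lemma almostPath_of_seq {S : Set X} {ε : ℝ} (hε : 0 < ε) {x y : X} {d : ℕ → X} {N : ℕ}
    (hN : 0 < N) (h0 : d 0 = x) (h1 : ∀ k ≥ N, d k = y) (hS : ∀ k, d k ∈ S)
    (hd : ∀ k, dist (d k) (d (k + 1)) < ε) :
    AlmostPath S ε x y fun t => d ⌊t * N⌋₊ := by
  have hN' : (0 : ℝ) < N := by exact_mod_cast hN
  refine ⟨fun t => hS _, fun t ht => ?_, fun t ht => ?_, 1 / N, by positivity,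
    dist_floor_lt hd hε hN⟩
  · dsimp only
    rw [Nat.floor_of_nonpos (by nlinarith), h0]
  · exact h1 _ (Nat.le_floor (by nlinarith))

lemma AlmostPath.refine {S T : Set X} {ε δ r : ℝ} {x y : X} {f : ℝ → X}
    (hf : AlmostPath S ε x y f) (hδ : 0 < δ)
    (hlink : ∀ a ∈ S, ∀ b ∈ S, dist a b < ε → Linked (T ∩ closedBall a r) δ a b)
    (hST : S ⊆ T) (hr : 0 ≤ r) :
    ∃ g, AlmostPath T δ x y g ∧ ∀ t, dist (f t) (g t) ≤ ε + r := by
  obtain ⟨hfS, hfx, hfy, η, hη, hfη⟩ := hf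
  obtain ⟨N', hN'η⟩ := exists_nat_one_div_lt hη
  set N := N' + 1 with hNdef
  have hN : (0 : ℝ) < N := by positivity
  have hNη : 1 / (N : ℝ) < η := by rw [hNdef]; exact_mod_cast hN'η
  have hε : 0 < ε := by
    have := hfη 0 0 (by simpa)
    rwa [dist_self] at this
  have hseq : ∀ i : ℕ, ∃ (m : ℕ) (d : ℕ → X), d 0 = f (i / N) ∧
      (∀ k ≥ m, d k = f ((i + 1 : ℕ) / N)) ∧ (∀ k, d k ∈ T ∩ closedBall (f (i / N)) r) ∧
      (∀ k, dist (d k) (d (k + 1)) < δ) ∧ (N ≤ i → m = 0) := by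
    intro i
    by_cases hi : N ≤ i
    · have h1 : f (i / N) = y := hfy _ ((one_le_div hN).2 (by exact_mod_cast hi))
      have h2 : f ((i + 1 : ℕ) / N) = y :=
        hfy _ ((one_le_div hN).2 (by exact_mod_cast hi.trans i.le_succ))
      refine ⟨0, fun _ => y, h1.symm, fun _ _ => h2.symm, fun _ => ?_, fun _ => by simpa,
        fun _ => rfl⟩
      rw [h1]
      exact ⟨h1 ▸ hST (hfS _), mem_closedBall_self hr⟩
    · have hl := hlink (f (i / N)) (hfS _) (f ((i + 1 : ℕ) / N)) (hfS _) (hfη _ _ (by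
        rw [dist_comm, Real.dist_eq, ← sub_div, abs_div, abs_of_pos hN]
        simpa using hNη))
      have hmem : f (i / N) ∈ T ∩ closedBall (f (i / N)) r :=
        ⟨hST (hfS _), mem_closedBall_self hr⟩
      obtain ⟨m, d, h⟩ := hl.exists_seq hδ hmem
      exact ⟨m, d, h.1, h.2.1, h.2.2.1, h.2.2.2, fun h' => absurd h' hi⟩
  choose m d hd0 hdm hdT hdδ hm0 using hseq
  set M := (Finset.range N).sup m + 1 with hM
  have hmM : ∀ i, m i ≤ M := by
    intro i
    by_cases hi : N ≤ i
    · rw [hm0 i hi]; omega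
    · have := Finset.le_sup (f := m) (Finset.mem_range.2 (not_le.1 hi))
      omega
  have hMpos : 0 < M := by omega
  let c : ℕ → X := fun k => d (k / M) (k % M)
  have hc : ∀ k, c k = d (k / M) (k % M) := fun _ => rfl
  refine ⟨fun t => c ⌊t * (N * M : ℕ)⌋₊, almostPath_of_seq hδ (by positivity) ?_ ?_ ?_ ?_, ?_⟩
  · rw [hc]
    simpa [hd0] using hfx 0 le_rfl
  · intro k hk
    have hi : N ≤ k / M := (Nat.le_div_iff_mul_le hMpos).2 hk
    rw [hc, hdm _ _ (by rw [hm0 _ hi]; omega)]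
    exact hfy _ ((one_le_div hN).2 (by exact_mod_cast hi.trans (Nat.le_succ _)))
  · exact fun k => (hdT _ _).1
  · intro k
    rw [hc, hc]
    have hlt := Nat.mod_lt k hMpos
    rcases eq_or_lt_of_le (Nat.succ_le_of_lt hlt) with h | h
    · have hk : k + 1 = M * (k / M + 1) := by
        rw [mul_add, mul_one]
        have := Nat.div_add_mod k M
        omega
      have h1 : (k + 1) / M = k / M + 1 := by rw [hk, Nat.mul_div_cancel_left _ hMpos]
      have h2 : (k + 1) % M = 0 := by rw [hk, Nat.mul_mod_right]
      rw [h1, h2, hd0]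
      have := hdδ (k / M) (k % M)
      rwa [hdm (k / M) (k % M + 1) (by rw [← Nat.succ_eq_add_one, h]; exact hmM _)] at this
    · have hk : k + 1 = k % M + 1 + M * (k / M) := by
        have := Nat.div_add_mod k M
        omega
      have h1 : (k + 1) / M = k / M := by
        rw [hk, Nat.add_mul_div_left _ _ hMpos, Nat.div_eq_of_lt h, zero_add]
      have h2 : (k + 1) % M = k % M + 1 := by
        rw [hk, Nat.add_mul_mod_self_left, Nat.mod_eq_of_lt h]
      rw [h1, h2]
      exact hdδ _ _
  · intro t
    rcases le_or_gt t 0 with ht | ht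
    · have : ⌊t * (N * M : ℕ)⌋₊ = 0 := Nat.floor_of_nonpos (by
        have : (0 : ℝ) ≤ (N * M : ℕ) := by positivity
        nlinarith)
      dsimp only
      rw [this, hc]
      simp only [Nat.zero_div, Nat.zero_mod, hd0]
      rw [hfx t ht, hfx _ (by simp), dist_self]
      positivity
    · have hdiv : ⌊t * (N * M : ℕ)⌋₊ / M = ⌊t * N⌋₊ := by
        rw [← Nat.floor_div_natCast]
        congr 1
        have : (M : ℝ) ≠ 0 := by positivity
        push_cast
        field_simp
      dsimp only
      rw [hc, hdiv]
      refine (dist_triangle _ (f (⌊t * N⌋₊ / N)) _).trans (add_le_add (hfη _ _ ?_).le ?_)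
      · refine lt_of_le_of_lt ?_ hNη
        rw [Real.dist_eq, abs_of_nonneg]
        · rw [sub_le_iff_le_add, ← add_div, le_div_iff₀ hN, add_comm]
          exact (Nat.lt_floor_add_one _).le
        · rw [sub_nonneg, div_le_iff₀ hN]
          exact Nat.floor_le (by positivity)
      · rw [dist_comm]
        exact (hdT _ _).2

open TupleChain

lemma linked_of_acyclic (R : Type) [CommRing R] [Nontrivial R] {K L : Set X}
    (h : Acyclic R K L) {x y : X} (hx : x ∈ K) (hy : y ∈ K) {ε : ℝ} (hε : 0 < ε) :
    Linked L ε x y := by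
  classical
  obtain ⟨δ, hδ, H⟩ := h ε hε
  have hsmall : ∀ a ∈ K, [a] ∈ Small K δ 1 := fun a ha => ⟨rfl, by simpa using ⟨ha, hδ⟩⟩
  have hbd1 : ∀ a : X, bd (Finsupp.single [a] (1 : R)) = Finsupp.single [] 1 := fun a => by
    rw [bd_cons, bd_nil, map_zero, sub_zero]
  obtain ⟨e, he, h2⟩ := H 1 (Nat.zero_le _) (Finsupp.single [x] 1 - Finsupp.single [y] 1)
    (Submodule.sub_mem _ (Finsupp.single_mem_supported R _ (hsmall x hx))
      (Finsupp.single_mem_supported R _ (hsmall y hy))) (by simp [hbd1])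
  let φ : (List X →₀ R) →ₗ[R] R :=
    Finsupp.linearCombination R fun l => if ∃ a, l = [a] ∧ Linked L ε x a then 1 else 0
  have hφ : ∀ a, φ (Finsupp.single [a] 1) = if Linked L ε x a then 1 else 0 := fun a => by
    simp [φ]
  have h0 : (φ ∘ₗ bd) e ∈ (⊥ : Submodule R R) := by
    refine map_mem_of_supported _ (fun l hl => ?_) he
    obtain ⟨a, b, rfl⟩ := List.length_eq_two.1 hl.1
    have hab := (hl.2 a (by simp))
    have hba := (hl.2 b (by simp))
    have hiff : Linked L ε x a ↔ Linked L ε x b :=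
      ⟨fun h => h.tail ⟨hab.1, hba.1, hab.2 b (by simp)⟩,
        fun h => h.tail ⟨hba.1, hab.1, hba.2 a (by simp)⟩⟩
    rw [Submodule.mem_bot, LinearMap.comp_apply, bd_cons, hbd1, cone_single, map_sub, hφ, hφ]
    simp [hiff]
  simp only [LinearMap.id_apply] at h2
  rw [Submodule.mem_bot, LinearMap.comp_apply, h2, map_sub, hφ, hφ, if_pos .refl] at h0
  by_contra hxy
  rw [if_neg hxy] at h0
  simp at h0

variable {R : Type} [CommRing R] [Nontrivial R] {A : Set X}

lemma TupleChain.AcyclicSet.nonempty (hA : AcyclicSet R A) : A.Nonempty := by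
  obtain ⟨L, hLA, -, -, h⟩ := hA.exists_superset ∅ (empty_subset _) isCompact_empty
  obtain ⟨δ, hδ, H⟩ := h 1 one_pos
  obtain ⟨e, he, h2⟩ := H 0 le_rfl (Finsupp.single [] 1)
    (Finsupp.single_mem_supported R _ ⟨rfl, by simp⟩) (by simp)
  by_contra hne
  have he0 : e = 0 := by
    ext l
    by_contra hl
    obtain ⟨h3, h4⟩ := he (Finsupp.mem_support_iff.2 hl)
    obtain ⟨a, rfl⟩ := List.length_eq_one_iff.1 h3
    exact hne ⟨a, hLA (h4 a (by simp)).1⟩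
  simp [he0, eq_comm] at h2

lemma TupleChain.AcyclicSet.exists_linked (hA : AcyclicSet R A) {C : Set X} (hC : IsCompact C)
    {r : ℝ} (hr : 0 < r) : ∃ s > 0, ∀ y ∈ A ∩ C, ∀ z ∈ A ∩ C, dist y z < s →
      ∀ ε > 0, Linked (A ∩ closedBall y r) ε y z := by
  have h := fun x (hx : x ∈ A) => hA.exists_closedBall x hx (r / 2) (half_pos hr)
  choose! s hs0 hsr hs using h
  have hAC : IsCompact (A ∩ C) := hC.inter_left hA.isClosed
  obtain ⟨η, hη, H⟩ := lebesgue_number_lemma_of_metric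
    (c := fun x : ↥(A ∩ C) => ball x.1 (s x.1)) hAC
    (fun _ => isOpen_ball) fun x hx => mem_iUnion.2 ⟨⟨x, hx⟩, mem_ball_self (hs0 x hx.1)⟩
  refine ⟨η, hη, fun y hy z hz hyz ε hε => ?_⟩
  obtain ⟨⟨x, hx⟩, hball⟩ := H y hy
  have hyx := hball (mem_ball_self hη)
  have hzx : z ∈ ball x (s x) := hball (by rwa [mem_ball, dist_comm])
  refine (linked_of_acyclic R (hs x hx.1) ⟨hy.1, ball_subset_closedBall hyx⟩
    ⟨hz.1, ball_subset_closedBall hzx⟩ hε).mono (inter_subset_inter_right _ ?_)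
  refine closedBall_subset_closedBall' ?_
  have := hsr x hx.1
  have : dist x y < s x := by rw [dist_comm]; exact hyx
  linarith

lemma TupleChain.AcyclicSet.joinedIn [LocallyCompactSpace X] (hA : AcyclicSet R A) {x y : X}
    (hx : x ∈ A) (hy : y ∈ A) : JoinedIn A x y := by
  obtain ⟨L, hLA, hL, hxyL, hLac⟩ := hA.exists_superset {x, y} (by simp [insert_subset_iff, *])
    (by simp)
  obtain ⟨ρ, hρ, hC⟩ := hL.exists_isCompact_cthickening
  have hr : ∀ n : ℕ, 0 < ρ / 4 / 2 ^ n := fun n => by positivity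
  have h := fun n => hA.exists_linked hC (hr n)
  choose s hs0 hs using h
  let ε : ℕ → ℝ := fun n => min (s n) (ρ / 4 / 2 ^ n)
  have hε : ∀ n, 0 < ε n := fun n => lt_min (hs0 n) (hr n)
  let S : ℕ → Set X := fun n => A ∩ {a | ∃ u ∈ L, dist a u ≤ ρ * (1 - 1 / 2 ^ n)}
  have hSC : ∀ n, S n ⊆ A ∩ cthickening ρ L := by
    rintro n a ⟨ha, u, hu, hau⟩
    refine ⟨ha, mem_cthickening_of_dist_le a u ρ L hu (hau.trans ?_)⟩
    have : (0 : ℝ) < 1 / 2 ^ n := by positivity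
    nlinarith
  have hstep : ∀ n, ∀ f : ℝ → X, AlmostPath (S n) (ε n) x y f → ∃ g : ℝ → X,
      AlmostPath (S (n + 1)) (ε (n + 1)) x y g ∧ ∀ t, dist (f t) (g t) ≤ ρ / 2 / 2 ^ n := by
    intro n f hf
    have hpow : (1 : ℝ) / 2 ^ n = 2 * (1 / 2 ^ (n + 1)) := by rw [pow_succ]; field_simp
    have hpos : (0 : ℝ) < 1 / 2 ^ (n + 1) := by positivity
    have hr4 : ρ / 4 / 2 ^ n = ρ / 2 * (1 / 2 ^ (n + 1)) := by rw [pow_succ]; field_simp; norm_num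
    have hstep' : ∀ a ∈ S n, A ∩ closedBall a (ρ / 4 / 2 ^ n) ⊆ S (n + 1) := by
      rintro a ⟨ha, u, hu, hau⟩ b ⟨hb, hba⟩
      refine ⟨hb, u, hu, (dist_triangle b a u).trans ?_⟩
      rw [mem_closedBall] at hba
      nlinarith
    obtain ⟨g, hg, hfg⟩ := hf.refine (T := S (n + 1)) (r := ρ / 4 / 2 ^ n) (hε (n + 1))
      (fun a ha b hb hab => ((hs n) a (hSC n ha) b (hSC n hb) (hab.trans_le (min_le_left _ _)) _
        (hε _)).mono (subset_inter (hstep' a ha) inter_subset_right))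
      (fun a ha => hstep' a ha ⟨ha.1, mem_closedBall_self (hr n).le⟩) (hr n).le
    refine ⟨g, hg, fun t => (hfg t).trans ?_⟩
    have := min_le_right (s n) (ρ / 4 / 2 ^ n)
    have h2 : ρ / 2 / 2 ^ n = ρ / 4 / 2 ^ n + ρ / 4 / 2 ^ n := by ring
    rw [h2]
    exact add_le_add this le_rfl
  obtain ⟨f₀, hf₀⟩ : ∃ f, AlmostPath (S 0) (ε 0) x y f := by
    have hlink := linked_of_acyclic R hLac (x := x) (y := y) (by simp) (by simp) (hε 0)
    obtain ⟨m, d, h0, hm, hdS, hd⟩ := hlink.exists_seq (hε 0) (hxyL (by simp))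
    refine ⟨_, almostPath_of_seq (hε 0) m.succ_pos h0 (fun k hk => hm k (by omega))
      (fun k => ⟨hLA (hdS k), d k, hdS k, by simp⟩) hd⟩
  choose! next hnext hnextd using hstep
  let f : ℕ → ℝ → X := fun n => Nat.rec f₀ next n
  have hf : ∀ n, AlmostPath (S n) (ε n) x y (f n) := by
    intro n
    induction n with
    | zero => exact hf₀
    | succ n ih => exact hnext n _ ih
  have hfd : ∀ t n, dist (f n t) (f (n + 1) t) ≤ ρ / 2 / 2 ^ n := fun t n => hnextd n _ (hf n) t
  have hlim : ∀ t, ∃ a ∈ A ∩ cthickening ρ L, Tendsto (fun n => f n t) atTop (𝓝 a) := fun t =>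
    cauchySeq_tendsto_of_isComplete (hC.inter_left hA.isClosed).isComplete
      (fun n => hSC n ((hf n).1 t)) (cauchySeq_of_le_geometric_two (hfd t))
  choose F hFA hF using hlim
  have hFd : ∀ t n, dist (f n t) (F t) ≤ ρ / 2 ^ n := fun t n =>
    dist_le_of_le_geometric_two_of_tendsto (hfd t) (hF t) n
  have hFc : Continuous F := by
    refine Metric.continuous_iff.2 fun t e he => ?_
    obtain ⟨n, hn⟩ : ∃ n : ℕ, 3 * ρ / 2 ^ n < e := by
      obtain ⟨n, hn⟩ := exists_pow_lt_of_lt_one (y := (1 / 2 : ℝ))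
        (show 0 < e / (3 * ρ) by positivity) (by norm_num)
      refine ⟨n, ?_⟩
      rw [lt_div_iff₀ (by positivity), one_div, inv_pow] at hn
      rw [div_eq_inv_mul]
      exact hn
    obtain ⟨η, hη, H⟩ := (hf n).2.2.2
    refine ⟨η, hη, fun t' ht' => ?_⟩
    have h1 := H t' t ht'
    have h2 : ε n ≤ ρ / 2 ^ n := (min_le_right _ _).trans (by gcongr; linarith)
    have h3 := hFd t' n
    have h4 := hFd t n
    have h5 := dist_triangle4 (F t') (f n t') (f n t) (F t)
    rw [dist_comm (F t') (f n t')] at h5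
    have h6 : 3 * ρ / 2 ^ n = ρ / 2 ^ n + ρ / 2 ^ n + ρ / 2 ^ n := by ring
    linarith
  refine JoinedIn.ofLine hFc.continuousOn ?_ ?_ ?_
  · exact tendsto_nhds_unique (hF 0) (tendsto_const_nhds.congr fun n => ((hf n).2.1 0 le_rfl).symm)
  · exact tendsto_nhds_unique (hF 1)
      (tendsto_const_nhds.congr fun n => ((hf n).2.2.1 1 le_rfl).symm)
  · rintro _ ⟨t, -, rfl⟩
    exact (hFA t).1

lemma TupleChain.AcyclicSet.isPathConnected [LocallyCompactSpace X] (hA : AcyclicSet R A) :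
    IsPathConnected A := by
  obtain ⟨x, hx⟩ := hA.nonempty
  exact ⟨x, hx, fun {_} hy => hA.joinedIn hx hy⟩

end Chains

section Action

variable {G X : Type} [Group G] [MulAction G X]

lemma Subgroup.eq_top_of_lt_of_index_prime {K S : Subgroup G} (hK : K.index.Prime) (h : K < S) :
    S = ⊤ := by
  have h1 := Subgroup.relIndex_mul_index h.le
  rcases (Nat.prime_mul_iff.1 (h1 ▸ hK)) with h2 | h2
  · exact Subgroup.index_eq_one.1 h2.2
  · exact absurd (Subgroup.relIndex_eq_one.1 h2.2) (not_le_of_gt h)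

lemma fixedPoints_eq_inter_of_index_prime {K : Subgroup G} (hK : K.index.Prime) {g : G}
    (hg : g ∉ K) :
    MulAction.fixedPoints G X = MulAction.fixedPoints K X ∩ {x | g • x = x} := by
  ext x
  refine ⟨fun h => ⟨fun k => h k, h g⟩, fun h => ?_⟩
  have hle : K ≤ MulAction.stabilizer G x := fun k hk => h.1 ⟨k, hk⟩
  have hlt : K < MulAction.stabilizer G x := lt_of_le_not_ge hle fun h' => hg (h' h.2)
  intro a
  have : a ∈ MulAction.stabilizer G x := by
    rw [Subgroup.eq_top_of_lt_of_index_prime hK hlt]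
    trivial
  exact this

lemma exists_normal_index_eq {p n : ℕ} (hp : p.Prime) [Finite G]
    (hG : Nat.card G = p ^ (n + 1)) :
    ∃ K : Subgroup G, K.Normal ∧ Nat.card K = p ^ n ∧ K.index = p := by
  have : Fact p.Prime := ⟨hp⟩
  obtain ⟨K, hK⟩ := Sylow.exists_subgroup_card_pow_prime p (G := G) (n := n)
    (hG ▸ pow_dvd_pow p n.le_succ)
  have hidx : K.index = p := by
    have := K.card_mul_index
    rw [hK, hG, pow_succ] at this
    exact Nat.eq_of_mul_eq_mul_left (pow_pos hp.pos n) this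
  refine ⟨K, Subgroup.normal_of_index_eq_minFac_card ?_, hK, hidx⟩
  rw [hidx, hG, hp.pow_minFac n.succ_ne_zero]

end Action

lemma TupleChain.AcyclicSet.fixedPoints {R X : Type} [CommRing R] [MetricSpace X]
    [LocallyCompactSpace X] (hX : AcyclicSet R (univ : Set X)) {p : ℕ} (hp : p.Prime)
    (hpR : (p : R) = 0) {D : ℕ} (hD : ∀ K : Set X, IsCompact K → CoverOrderLE K D) (n : ℕ) :
    ∀ (G : Type) [Group G] [MulAction G X], Finite G → Nat.card G = p ^ n →
      (∀ g : G, Isometry fun x : X => g • x) → AcyclicSet R (MulAction.fixedPoints G X) := by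
  induction n with
  | zero =>
    intro G _ _ _ hG _
    rw [pow_zero, Nat.card_eq_one_iff_unique] at hG
    have := hG.1
    convert hX
    refine eq_univ_of_forall fun x g => ?_
    rw [Subsingleton.elim g 1, one_smul]
  | succ n ih =>
    intro G _ _ _ hG hiso
    obtain ⟨K, hKn, hKc, hKi⟩ := exists_normal_index_eq hp hG
    obtain ⟨g, hg⟩ : ∃ g, g ∉ K := by
      by_contra! h
      rw [(Subgroup.eq_top_iff' K).2 h, Subgroup.index_top] at hKi
      exact hp.one_lt.ne hKi
    rw [fixedPoints_eq_inter_of_index_prime (hKi ▸ hp) hg]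
    refine (ih K inferInstance hKc fun k => hiso k).inter_fixed hp hpR (hiso g)
      (fun x hx k => ?_) (fun x hx => ?_) hD
    · have h1 := hx ⟨g⁻¹ * k * g, by simpa using hKn.conj_mem k k.2 g⁻¹⟩
      rw [Subgroup.mk_smul, mul_smul, mul_smul, inv_smul_eq_iff] at h1
      exact h1
    · rw [smul_iterate]
      exact hx ⟨g ^ p, hKi ▸ K.pow_index_mem g⟩

lemma exists_metric_isometry_smul (G M : Type) [Group G] [Finite G] [t : TopologicalSpace M]
    [TopologicalSpace.MetrizableSpace M] [MulAction G M]
    (hcont : ∀ g : G, Continuous (fun x : M => g • x)) :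
    ∃ m : MetricSpace M, m.toUniformSpace.toTopologicalSpace = t ∧
      ∀ g : G, Isometry fun x : M => g • x := by
  have := Fintype.ofFinite G
  let m₀ := TopologicalSpace.metrizableSpaceMetric M
  let φ : M → G → M := fun x g => g • x
  have hφ : IsEmbedding φ := IsEmbedding.of_leftInverse (f := fun y => y 1)
    (fun x => one_smul G x) (continuous_apply 1) (continuous_pi hcont)
  have hle : ∀ (g : G) (x y : M), dist (φ (g • x)) (φ (g • y)) ≤ dist (φ x) (φ y) := by
    intro g x y
    refine (dist_pi_le_iff dist_nonneg).2 fun a => ?_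
    simpa [φ, mul_smul] using dist_le_pi_dist (φ x) (φ y) (a * g)
  refine ⟨hφ.comapMetricSpace φ, rfl, fun g => ?_⟩
  let m : MetricSpace M := hφ.comapMetricSpace φ
  refine Isometry.of_dist_eq fun x y => le_antisymm (hle g x y) ?_
  have h := hle g⁻¹ (g • x) (g • y)
  rw [inv_smul_smul, inv_smul_smul] at h
  exact h

lemma IsTopologicalManifold.exists_chart {M : Type} [TopologicalSpace M]
    (hM : IsTopologicalManifold M) (x : M) :
    ∃ (n : ℕ) (e : OpenPartialHomeomorph M (Fin n → ℝ)), x ∈ e.source := by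
  obtain ⟨n, U, V, hU, hx, hV, ⟨h⟩⟩ := hM.2.2 x
  have hne : Nonempty U := ⟨⟨x, hx⟩⟩
  have hne' : Nonempty V := hne.map h
  let eU := TopologicalSpace.Opens.openPartialHomeomorphSubtypeCoe ⟨U, hU⟩ hne
  let eV := TopologicalSpace.Opens.openPartialHomeomorphSubtypeCoe ⟨V, hV⟩ hne'
  refine ⟨n, eU.symm.trans (h.toOpenPartialHomeomorph.trans eV), ?_⟩
  simp [eU, eV, hx]

lemma locallyCompactSpace_of_charts {M : Type} [TopologicalSpace M] [T2Space M]
    (hch : ∀ x : M, ∃ (n : ℕ) (e : OpenPartialHomeomorph M (Fin n → ℝ)), x ∈ e.source) :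
    LocallyCompactSpace M := by
  have : WeaklyLocallyCompactSpace M := by
    refine ⟨fun x => ?_⟩
    obtain ⟨n, e, hx⟩ := hch x
    obtain ⟨K, hK, hKt, hKc⟩ := local_compact_nhds (e.open_target.mem_nhds (e.map_source hx))
    refine ⟨e.symm '' K, hKc.image_of_continuousOn (e.continuousOn_symm.mono hKt), ?_⟩
    rw [← e.symm_map_nhds_eq hx]
    exact image_mem_map hK
  infer_instance

end FixedPointTheory

/-- If a finite `p`-group `G` acts continuously on a contractible topological
manifold `M`, then the fixed-point set `M^G` is nonempty and path-connected. -/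
theorem fixedPoints_pathConnected (p : ℕ) (hp : p.Prime)
    (G M : Type) [Group G] [Finite G] (hpG : IsPGroup p G)
    [TopologicalSpace M] (hM : IsTopologicalManifold M) [ContractibleSpace M]
    [MulAction G M] (hcont : ∀ g : G, Continuous (fun x : M => g • x)) :
    (MulAction.fixedPoints G M).Nonempty ∧ IsPathConnected (MulAction.fixedPoints G M) := by
  suffices h : IsPathConnected (MulAction.fixedPoints G M) from ⟨h.nonempty, h⟩
  have : Fact p.Prime := ⟨hp⟩
  have := hM.1
  have := hM.2.1
  have hch := hM.exists_chart
  have := locallyCompactSpace_of_charts hch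
  have := TopologicalSpace.metrizableSpace_of_t3_secondCountable M
  obtain ⟨m, rfl, hiso⟩ := exists_metric_isometry_smul G M hcont
  obtain ⟨n, hn⟩ := hpG.exists_card_eq
  obtain ⟨D, hD⟩ := exists_coverOrderLE hch
  exact ((TupleChain.acyclicSet_univ (ZMod p) hch).fixedPoints hp (by simp) hD n G ‹_› hn
    hiso).isPathConnected
end

section
/- Let p : M̃ → M be a covering map, and let a group G act by homeomorphisms on both M̃ and M such that p is G-equivariant (p(g·y) = g·p(y) for all g, y). Suppose x̃ ∈ M̃ is fixed by every element of G, and set x = p(x̃). If y ∈ M lies in the same path-component of the fixed set M^G = {m ∈ M | g·m = m for all g ∈ G} as x (with its subspace topology), then y = p(ỹ) for some ỹ ∈ M̃ fixed by every element of G. -/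
/-- Let `p : M̃ → M` be a covering map, equivariant for continuous actions of a
group `G` on `M̃` and `M`.  If `x̃ ∈ M̃` is fixed by `G` and `y ∈ M` lies in the
same path-component of the fixed set `M^G` (with its subspace topology) as
`x = p x̃`, then `y` lifts to a point of `M̃` fixed by `G`. -/
theorem fixed_point_lifts_along_fixed_path_component {G MT M : Type} [Group G]
    [TopologicalSpace MT] [TopologicalSpace M]
    [MulAction G MT] [MulAction G M]
    (hcontT : ∀ g : G, Continuous (fun y : MT => g • y))
    (hcont : ∀ g : G, Continuous (fun y : M => g • y))
    (p : MT → M) (hp : IsCoveringMap p)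
    (heqv : ∀ (g : G) (y : MT), p (g • y) = g • p y)
    (xt : MT) (hxt : ∀ g : G, g • xt = xt)
    (y : M) (hy : JoinedIn (MulAction.fixedPoints G M) (p xt) y) :
    ∃ yt : MT, (∀ g : G, g • yt = yt) ∧ p yt = y := by
  obtain ⟨γ, hγ⟩ := hy
  obtain ⟨Γ, hΓ, hΓ₀⟩ := hp.exists_path_lifts (γ : C(unitInterval, M)) xt γ.source
  have lifts (t : unitInterval) : p (Γ t) = γ t := congr_fun hΓ t
  refine ⟨Γ 1, fun g => ?_, (lifts 1).trans γ.target⟩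
  have translate_eq : (fun t => g • Γ t) = Γ := by
    refine hp.eq_of_comp_eq ((hcontT g).comp Γ.continuous) Γ.continuous ?_ 0 ?_
    · funext t
      simp only [Function.comp_apply, heqv, lifts]
      exact hγ t g
    · rw [hΓ₀, hxt]
  exact congr_fun translate_eq 1
end

section
/- Let G be a finite group, and let X and Y be metric spaces on which G acts semifreely by isometries. Let q ∈ Y be a fixed point of G that is isolated in the fixed set Y^G. Let t^qY denote the homotopy link of q in Y, with its G-action (g·σ)(t) = g·σ(t), and let t_qY = t^qY ∪ {σ_q}, where σ_q is the constant path at q, topologized as a subspace of the space of continuous maps [0,1] → Y with the topology of uniform convergence. Call a G-equivariant continuous map f : X → t_qY isovariant if f(x) = σ_q exactly for x ∈ X^G, and call two isovariant maps isovariantly homotopic if they are joined by a homotopy through isovariant maps; similarly, two G-equivariant continuous maps X − X^G → t^qY are G-homotopic if they are joined by a homotopy through G-equivariant maps. Then the rule f ↦ f|_{X−X^G} induces a well-defined bijection from the set of isovariant G-homotopy classes of isovariant maps X → t_qY onto the set of G-homotopy classes of G-equivariant maps X − X^G → t^qY. -/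
open unitInterval

section HomotopyLink

variable (G : Type) {X Y : Type} [Group G] [MetricSpace X] [MetricSpace Y]
  [MulAction G X] [MulAction G Y]

/-- `f : X → t_qY` is an *isovariant* map into the homotopy tangent space of `q`:
`f` is continuous and `G`-equivariant (for the action `(g • σ)(t) = g • σ(t)` on
paths), `f x` is the constant path `σ_q` exactly for `x ∈ X^G`, and for
`x ∉ X^G` the path `f x` lies in the homotopy link `t^qY`, i.e. it hits `q`
exactly at time `0`. -/
def IsIsovariantMap (q : Y) (f : X → C(unitInterval, Y)) : Prop :=
  Continuous f ∧
  (∀ (g : G) (x : X) (t : unitInterval), f (g • x) t = g • f x t) ∧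
  (∀ x : X, x ∈ MulAction.fixedPoints G X ↔ f x = ContinuousMap.const unitInterval q) ∧
  (∀ x : X, x ∉ MulAction.fixedPoints G X → (f x : unitInterval → Y) ⁻¹' {q} = {0})

/-- `F : X - X^G → t^qY` is a continuous `G`-equivariant map into the homotopy
link of `q`, i.e. each path `F x` hits `q` exactly at time `0`. -/
def IsEquivariantMap (q : Y)
    (F : {x : X // x ∉ MulAction.fixedPoints G X} → C(unitInterval, Y)) : Prop :=
  Continuous F ∧
  (∀ (g : G) (x x' : {x : X // x ∉ MulAction.fixedPoints G X}),
    (x' : X) = g • (x : X) → ∀ t : unitInterval, F x' t = g • F x t) ∧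
  (∀ x, (F x : unitInterval → Y) ⁻¹' {q} = {0})

/-- Two isovariant maps `X → t_qY` are isovariantly homotopic: they are joined
by a (jointly continuous) homotopy through isovariant maps. -/
def IsovariantlyHomotopic (q : Y) (f₀ f₁ : X → C(unitInterval, Y)) : Prop :=
  ∃ H : unitInterval → X → C(unitInterval, Y),
    Continuous (fun p : unitInterval × X => H p.1 p.2) ∧
    (∀ s : unitInterval, IsIsovariantMap G q (H s)) ∧ H 0 = f₀ ∧ H 1 = f₁

/-- Two equivariant maps `X - X^G → t^qY` are `G`-homotopic: they are joined by
a (jointly continuous) homotopy through `G`-equivariant maps. -/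
def EquivariantlyHomotopic (q : Y)
    (F₀ F₁ : {x : X // x ∉ MulAction.fixedPoints G X} → C(unitInterval, Y)) : Prop :=
  ∃ H : unitInterval → {x : X // x ∉ MulAction.fixedPoints G X} → C(unitInterval, Y),
    Continuous (fun p : unitInterval × {x : X // x ∉ MulAction.fixedPoints G X} => H p.1 p.2) ∧
    (∀ s : unitInterval, IsEquivariantMap G q (H s)) ∧ H 0 = F₀ ∧ H 1 = F₁

end HomotopyLink

namespace HomotopyLink

open MulAction

set_option linter.unusedSectionVars false

/-- The path `t ↦ p (c * t)`: the initial piece of `p` of length `c`, run at speed `c`. -/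
def scalePath {Y : Type*} [TopologicalSpace Y] (p : C(unitInterval, Y)) (c : unitInterval) :
    C(unitInterval, Y) :=
  ⟨fun t => p (c * t), by fun_prop⟩

@[simp] lemma scalePath_apply {Y : Type*} [TopologicalSpace Y] (p : C(unitInterval, Y))
    (c t : unitInterval) : scalePath p c t = p (c * t) := rfl

@[simp] lemma scalePath_one {Y : Type*} [TopologicalSpace Y] (p : C(unitInterval, Y)) :
    scalePath p 1 = p := by
  ext t; simp

lemma continuous_scalePath {Y Z : Type*} [TopologicalSpace Y] [TopologicalSpace Z]
    {p : Z → C(unitInterval, Y)} {c : Z → unitInterval} (hp : Continuous p) (hc : Continuous c) :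
    Continuous fun z => scalePath (p z) (c z) := by
  apply ContinuousMap.continuous_of_continuous_uncurry
  change Continuous fun w : Z × unitInterval => p w.1 (c w.1 * w.2)
  fun_prop

/-- The interpolation `1 - s * (1 - c)` from `1` to `c`. -/
def interp (s c : unitInterval) : unitInterval := σ (s * σ c)

@[simp] lemma interp_zero (c : unitInterval) : interp 0 c = 1 := by simp [interp]

@[simp] lemma interp_one (c : unitInterval) : interp 1 c = c := by simp [interp]

@[fun_prop]
lemma continuous_interp {Z : Type*} [TopologicalSpace Z] {s c : Z → unitInterval}
    (hs : Continuous s) (hc : Continuous c) : Continuous fun z => interp (s z) (c z) := by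
  unfold interp; fun_prop

lemma interp_pos (s : unitInterval) {c : unitInterval} (hc : 0 < c) : 0 < interp s c := by
  have h : (s * σ c : unitInterval) ≤ σ c := mul_le_of_le_one_left' s.2.2
  have h' : c ≤ interp s c := by
    rw [interp, unitInterval.le_symm_comm]
    exact h
  exact hc.trans_le h'

variable {G X Y : Type} [Group G] [MetricSpace X] [MetricSpace Y] [MulAction G X] [MulAction G Y]
  {q : Y}

lemma isClosed_fixedPoints_of_isometry (hX : ∀ g : G, Isometry (fun x : X => g • x)) :
    IsClosed (fixedPoints G X) := by
  have : fixedPoints G X = ⋂ g : G, {x : X | g • x = x} := by ext x; simp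
  rw [this]
  exact isClosed_iInter fun g => isClosed_eq (hX g).continuous continuous_id

lemma smul_notMem_fixedPoints {x : X} (hx : x ∉ fixedPoints G X) (g : G) :
    g • x ∉ fixedPoints G X := by
  intro h
  apply hx
  have : x = g • x := by
    have := h g⁻¹
    rwa [inv_smul_smul] at this
  rwa [this]

/-- A bounded invariant gauge function vanishing exactly on the fixed set. -/
lemma exists_invariant_gauge (hX : ∀ g : G, Isometry (fun x : X => g • x)) :
    ∃ δ : X → ℝ, Continuous δ ∧ (∀ x, δ x ≤ 1) ∧ (∀ x ∈ fixedPoints G X, δ x = 0) ∧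
      (∀ x ∉ fixedPoints G X, 0 < δ x) ∧ ∀ (g : G) x, δ (g • x) = δ x := by
  rcases (fixedPoints G X).eq_empty_or_nonempty with h | h
  · exact ⟨fun _ => 1, continuous_const, fun _ => le_rfl, by simp [h], by simp, by simp⟩
  refine ⟨fun x => min 1 (Metric.infDist x (fixedPoints G X)),
    continuous_const.min (Metric.continuous_infDist_pt _), fun _ => min_le_left _ _,
    fun x hx => by simp [Metric.infDist_zero_of_mem hx], fun x hx => ?_, fun g x => ?_⟩
  · exact lt_min one_pos
      (((isClosed_fixedPoints_of_isometry hX).notMem_iff_infDist_pos h).1 hx)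
  · have himage : (fun x : X => g • x) '' fixedPoints G X = fixedPoints G X := by
      ext y
      constructor
      · rintro ⟨x, hx, rfl⟩
        simpa [hx g] using hx
      · exact fun hy => ⟨y, hy, hy g⟩
    have := Metric.infDist_image (hX g) (x := x) (t := fixedPoints G X)
    rw [himage] at this
    simp only [this]

lemma _root_.IsEquivariantMap.apply_zero {F : {x : X // x ∉ fixedPoints G X} → C(unitInterval, Y)}
    (hF : IsEquivariantMap G q F) (x) : F x 0 = q := by
  have : (0 : unitInterval) ∈ (F x : unitInterval → Y) ⁻¹' {q} := by rw [hF.2.2 x]; rfl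
  exact this

lemma _root_.IsEquivariantMap.apply_ne {F : {x : X // x ∉ fixedPoints G X} → C(unitInterval, Y)}
    (hF : IsEquivariantMap G q F) (x) {t : unitInterval} (ht : t ≠ 0) : F x t ≠ q := by
  intro h
  have : t ∈ (F x : unitInterval → Y) ⁻¹' {q} := h
  rw [hF.2.2 x] at this
  exact ht this

/-- Shrinking the paths of an equivariant map by an invariant positive factor. -/
lemma _root_.IsEquivariantMap.scalePath {F : {x : X // x ∉ fixedPoints G X} → C(unitInterval, Y)}
    (hF : IsEquivariantMap G q F) {c : {x : X // x ∉ fixedPoints G X} → unitInterval}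
    (hc : Continuous c) (hpos : ∀ x, 0 < c x)
    (hinv : ∀ (g : G) (x x' : {x : X // x ∉ fixedPoints G X}), (x' : X) = g • (x : X) →
      c x' = c x) :
    IsEquivariantMap G q fun x => scalePath (F x) (c x) := by
  refine ⟨continuous_scalePath hF.1 hc, fun g x x' h t => ?_, fun x => ?_⟩
  · simp [hinv g x x' h, hF.2.1 g x x' h]
  · ext t
    simp only [Set.mem_preimage, Set.mem_singleton_iff, scalePath_apply]
    constructor
    · intro h
      by_contra ht
      exact hF.apply_ne x (mul_ne_zero (hpos x).ne' ht) h
    · rintro rfl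
      simpa using hF.apply_zero x

/-- A map defined off the fixed set, extended by the constant path `q`. -/
noncomputable def extendConst (q : Y)
    (F : {x : X // x ∉ fixedPoints G X} → C(unitInterval, Y)) (x : X) : C(unitInterval, Y) :=
  open Classical in
  if h : x ∈ fixedPoints G X then ContinuousMap.const unitInterval q else F ⟨x, h⟩

lemma extendConst_of_mem (F : {x : X // x ∉ fixedPoints G X} → C(unitInterval, Y)) {x : X}
    (hx : x ∈ fixedPoints G X) : extendConst q F x = ContinuousMap.const unitInterval q :=
  dif_pos hx

lemma extendConst_of_notMem (F : {x : X // x ∉ fixedPoints G X} → C(unitInterval, Y)) {x : X}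
    (hx : x ∉ fixedPoints G X) : extendConst q F x = F ⟨x, hx⟩ :=
  dif_neg hx

@[simp] lemma extendConst_coe (F : {x : X // x ∉ fixedPoints G X} → C(unitInterval, Y))
    (x : {x : X // x ∉ fixedPoints G X}) : extendConst q F (x : X) = F x :=
  extendConst_of_notMem F x.2

lemma _root_.IsIsovariantMap.extendConst_restrict {f : X → C(unitInterval, Y)}
    (hf : IsIsovariantMap G q f) :
    extendConst q (fun x : {x : X // x ∉ fixedPoints G X} => f x.1) = f := by
  funext x
  by_cases hx : x ∈ fixedPoints G X
  · rw [extendConst_of_mem _ hx, (hf.2.2.1 x).1 hx]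
  · rw [extendConst_of_notMem _ hx]

lemma _root_.IsIsovariantMap.restrict {f : X → C(unitInterval, Y)} (hf : IsIsovariantMap G q f) :
    IsEquivariantMap G q (fun x => f x.1) :=
  ⟨hf.1.comp continuous_subtype_val, fun g x x' h t => by simp only [h, hf.2.1],
    fun x => hf.2.2.2 x.1 x.2⟩

lemma continuous_extendConst (hX : ∀ g : G, Isometry (fun x : X => g • x))
    {F : unitInterval → {x : X // x ∉ fixedPoints G X} → C(unitInterval, Y)}
    (hF : Continuous fun p : unitInterval × {x : X // x ∉ fixedPoints G X} => F p.1 p.2)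
    {b : X → ℝ} (hb : Continuous b) (hb0 : ∀ x ∈ fixedPoints G X, b x = 0)
    (hFb : ∀ s x, dist (F s x) (ContinuousMap.const unitInterval q) ≤ b x) :
    Continuous fun p : unitInterval × X => extendConst q (F p.1) p.2 := by
  rw [continuous_iff_continuousAt]
  rintro ⟨s, x⟩
  by_cases hx : x ∈ fixedPoints G X
  · rw [ContinuousAt, extendConst_of_mem _ hx, tendsto_iff_dist_tendsto_zero]
    have hlim : Filter.Tendsto (fun p : unitInterval × X => |b p.2|) (nhds (s, x)) (nhds 0) := by
      have : Continuous fun p : unitInterval × X => |b p.2| := by fun_prop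
      simpa [hb0 x hx] using this.tendsto (s, x)
    refine squeeze_zero (fun _ => dist_nonneg) (fun p => ?_) hlim
    by_cases hp : p.2 ∈ fixedPoints G X
    · rw [extendConst_of_mem _ hp, dist_self]
      exact abs_nonneg _
    · rw [extendConst_of_notMem _ hp]
      exact (hFb p.1 ⟨p.2, hp⟩).trans (le_abs_self _)
  · have hopen : IsOpen {p : unitInterval × X | p.2 ∉ fixedPoints G X} :=
      (isClosed_fixedPoints_of_isometry hX).isOpen_compl.preimage continuous_snd
    refine ContinuousOn.continuousAt (s := {p | p.2 ∉ fixedPoints G X}) ?_ (hopen.mem_nhds hx)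
    rw [continuousOn_iff_continuous_domRestrict]
    have hcomp : Continuous fun p : {p : unitInterval × X | p.2 ∉ fixedPoints G X} =>
        F p.1.1 ⟨p.1.2, p.2⟩ :=
      hF.comp (f := fun p : {p : unitInterval × X | p.2 ∉ fixedPoints G X} =>
        (p.1.1, (⟨p.1.2, p.2⟩ : {x : X // x ∉ fixedPoints G X}))) (by fun_prop)
    convert hcomp using 2 with p
    exact extendConst_of_notMem _ p.2

lemma isIsovariantMap_extendConst (hq : q ∈ fixedPoints G Y)
    {F : {x : X // x ∉ fixedPoints G X} → C(unitInterval, Y)} (hF : IsEquivariantMap G q F)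
    (hcont : Continuous (extendConst q F)) : IsIsovariantMap G q (extendConst q F) := by
  refine ⟨hcont, fun g x t => ?_, fun x => ⟨extendConst_of_mem F, fun h => ?_⟩, fun x hx => ?_⟩
  · by_cases hx : x ∈ fixedPoints G X
    · rw [hx g, extendConst_of_mem _ hx]
      exact (hq g).symm
    · rw [extendConst_of_notMem _ hx, extendConst_of_notMem _ (smul_notMem_fixedPoints hx g)]
      exact hF.2.1 g _ _ rfl t
  · by_contra hx
    rw [extendConst_of_notMem _ hx] at h
    exact hF.apply_ne ⟨x, hx⟩ one_ne_zero (by rw [h]; rfl)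
  · rw [extendConst_of_notMem _ hx]
    exact hF.2.2 _

/-- A homotopy through equivariant maps whose paths tend uniformly to `q` near the fixed set
extends to a homotopy through isovariant maps. -/
lemma isovariantlyHomotopic_extendConst (hX : ∀ g : G, Isometry (fun x : X => g • x))
    (hq : q ∈ fixedPoints G Y)
    {F : unitInterval → {x : X // x ∉ fixedPoints G X} → C(unitInterval, Y)}
    (hF : Continuous fun p : unitInterval × {x : X // x ∉ fixedPoints G X} => F p.1 p.2)
    (hFeq : ∀ s, IsEquivariantMap G q (F s))
    {b : X → ℝ} (hb : Continuous b) (hb0 : ∀ x ∈ fixedPoints G X, b x = 0)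
    (hFb : ∀ s x, dist (F s x) (ContinuousMap.const unitInterval q) ≤ b x) :
    IsovariantlyHomotopic G q (extendConst q (F 0)) (extendConst q (F 1)) := by
  have hcont := continuous_extendConst hX hF hb hb0 hFb
  exact ⟨fun s => extendConst q (F s), hcont,
    fun s => isIsovariantMap_extendConst hq (hFeq s) (hcont.comp (by fun_prop :
      Continuous fun x : X => (s, x))), rfl, rfl⟩

lemma dist_scalePath_const_le (p : C(unitInterval, Y)) (c : unitInterval) :
    dist (scalePath p c) (ContinuousMap.const unitInterval q) ≤
      dist p (ContinuousMap.const unitInterval q) :=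
  (ContinuousMap.dist_le dist_nonneg).2 fun t =>
    ContinuousMap.dist_apply_le_dist (f := p) (g := ContinuousMap.const unitInterval q) (c * t)

/-- Isovariant maps are isovariantly homotopic to their rescalings. -/
lemma _root_.IsIsovariantMap.homotopic_scalePath (hX : ∀ g : G, Isometry (fun x : X => g • x))
    (hq : q ∈ fixedPoints G Y) {f : X → C(unitInterval, Y)} (hf : IsIsovariantMap G q f)
    {c : {x : X // x ∉ fixedPoints G X} → unitInterval}
    (hc : Continuous c) (hpos : ∀ x, 0 < c x)
    (hinv : ∀ (g : G) (x x' : {x : X // x ∉ fixedPoints G X}), (x' : X) = g • (x : X) →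
      c x' = c x) :
    IsovariantlyHomotopic G q f (extendConst q fun x => HomotopyLink.scalePath (f x.1) (c x)) := by
  have hfc := hf.1
  have key := isovariantlyHomotopic_extendConst hX hq
    (F := fun s x => HomotopyLink.scalePath (f x.1) (interp s (c x)))
    (continuous_scalePath (by fun_prop) (by fun_prop))
    (fun s => hf.restrict.scalePath (by fun_prop)
      (fun x => interp_pos s (hpos x)) fun g x x' h => by simp only [hinv g x x' h])
    (b := fun x => dist (f x) (ContinuousMap.const unitInterval q)) (by fun_prop)
    (fun x hx => by simp [(hf.2.2.1 x).1 hx]) (fun s x => dist_scalePath_const_le _ _)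
  simpa only [interp_zero, interp_one, scalePath_one, hf.extendConst_restrict] using key

/-- Equivariant maps are equivariantly homotopic to their rescalings. -/
lemma _root_.IsEquivariantMap.homotopic_scalePath
    {F : {x : X // x ∉ fixedPoints G X} → C(unitInterval, Y)} (hF : IsEquivariantMap G q F)
    {c : {x : X // x ∉ fixedPoints G X} → unitInterval}
    (hc : Continuous c) (hpos : ∀ x, 0 < c x)
    (hinv : ∀ (g : G) (x x' : {x : X // x ∉ fixedPoints G X}), (x' : X) = g • (x : X) →
      c x' = c x) :
    EquivariantlyHomotopic G q (fun x => HomotopyLink.scalePath (F x) (c x)) F := by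
  have hFc := hF.1
  refine ⟨fun s x => HomotopyLink.scalePath (F x) (interp (σ s) (c x)),
    continuous_scalePath (by fun_prop) (by fun_prop),
    fun s => hF.scalePath (by fun_prop)
      (fun x => interp_pos _ (hpos x)) fun g x x' h => by simp only [hinv g x x' h], ?_, ?_⟩ <;>
  simp

/-- Along a homotopy through equivariant maps, the paths can be cut down invariantly and
continuously so that they stay close to `q` in terms of a prescribed invariant gauge. -/
lemma exists_scale (hY : ∀ g : G, Isometry (fun y : Y => g • y)) (hq : q ∈ fixedPoints G Y)
    {F : unitInterval → {x : X // x ∉ fixedPoints G X} → C(unitInterval, Y)}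
    (hF : Continuous fun p : unitInterval × {x : X // x ∉ fixedPoints G X} => F p.1 p.2)
    (hFeq : ∀ s, IsEquivariantMap G q (F s))
    {δ : X → ℝ} (hδ : Continuous δ) (hδ1 : ∀ x, δ x ≤ 1)
    (hδpos : ∀ x ∉ fixedPoints G X, 0 < δ x) (hδinv : ∀ (g : G) x, δ (g • x) = δ x) :
    ∃ c : {x : X // x ∉ fixedPoints G X} → unitInterval, Continuous c ∧ (∀ x, 0 < c x) ∧
      (∀ (g : G) (x x' : {x : X // x ∉ fixedPoints G X}), (x' : X) = g • (x : X) →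
        c x' = c x) ∧
      ∀ s x, dist (scalePath (F s x) (c x)) (ContinuousMap.const unitInterval q) ≤ δ x := by
  let φ : {x : X // x ∉ fixedPoints G X} → unitInterval × unitInterval → ℝ :=
    fun x w => max (w.2 : ℝ) (δ x - dist (F w.1 x w.2) q)
  have hφ : Continuous (Function.uncurry φ) := by
    have h1 : Continuous fun z : {x : X // x ∉ fixedPoints G X} × (unitInterval × unitInterval) =>
        F z.2.1 z.1 z.2.2 :=
      (hF.comp (f := fun z : {x : X // x ∉ fixedPoints G X} × (unitInterval × unitInterval) =>
        (z.2.1, z.1)) (by fun_prop)).eval (by fun_prop)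
    change Continuous fun z : {x : X // x ∉ fixedPoints G X} × (unitInterval × unitInterval) =>
      max (z.2.2 : ℝ) (δ z.1 - dist (F z.2.1 z.1 z.2.2) q)
    fun_prop
  have hφx : ∀ x, Continuous (φ x) := fun x => hφ.comp (by fun_prop : Continuous fun w => (x, w))
  have hφpos : ∀ x w, 0 < φ x w := by
    rintro x ⟨s, t⟩
    rcases eq_or_ne t 0 with rfl | ht
    · simpa [φ, (hFeq s).apply_zero x] using hδpos x.1 x.2
    · exact lt_max_of_lt_left (unitInterval.pos_iff_ne_zero.2 ht)
  let m : {x : X // x ∉ fixedPoints G X} → ℝ := fun x => sInf (φ x '' Set.univ)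
  have hm : Continuous m := isCompact_univ.continuous_sInf hφ
  have hmle : ∀ x w, m x ≤ φ x w := fun x w =>
    csInf_le (isCompact_univ.image (hφx x)).bddBelow ⟨w, trivial, rfl⟩
  have hmpos : ∀ x, 0 < m x := by
    intro x
    obtain ⟨w, -, hw⟩ := (isCompact_univ.image (hφx x)).sInf_mem (Set.univ_nonempty.image _)
    change 0 < sInf _
    rw [← hw]
    exact hφpos x w
  have hm1 : ∀ x, m x ≤ 1 := fun x => (hmle x (0, 0)).trans (max_le zero_le_one
    ((sub_le_self _ dist_nonneg).trans (hδ1 x)))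
  have hnear : ∀ s x (u : unitInterval), (u : ℝ) ≤ m x / 2 → dist (F s x u) q ≤ δ x := by
    intro s x u hu
    rcases le_max_iff.1 (hmle x (s, u)) with h | h <;> dsimp only at h <;> linarith [hmpos x]
  refine ⟨fun x => ⟨m x / 2, by linarith [hmpos x], by linarith [hm1 x]⟩,
    by fun_prop, fun x => half_pos (hmpos x), fun g x x' h => ?_, fun s x => ?_⟩
  · have : φ x' = φ x := by
      funext w
      simp only [φ, h, hδinv, (hFeq w.1).2.1 g x x' h]
      congr 2
      conv_lhs => rw [← hq g]
      exact (hY g).dist_eq _ _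
    simp only [m, this]
  · refine (ContinuousMap.dist_le (hδpos x.1 x.2).le).2 fun t => ?_
    refine hnear s x _ ?_
    exact mul_le_of_le_one_right (half_pos (hmpos x)).le t.2.2

lemma isovariantlyHomotopic_iff (f₀ f₁ : C(X, C(unitInterval, Y))) :
    IsovariantlyHomotopic G q f₀ f₁ ↔
      ContinuousMap.HomotopicWith f₀ f₁ fun f => IsIsovariantMap G q f := by
  constructor
  · rintro ⟨H, hc, hi, h0, h1⟩
    exact ⟨{ toFun := fun p => H p.1 p.2
             continuous_toFun := hc
             map_zero_left := fun x => congrFun h0 x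
             map_one_left := fun x => congrFun h1 x
             prop' := hi }⟩
  · rintro ⟨H⟩
    exact ⟨fun s x => H (s, x), H.continuous, H.prop, funext H.apply_zero, funext H.apply_one⟩

lemma _root_.IsovariantlyHomotopic.continuous_left {f₀ f₁ : X → C(unitInterval, Y)}
    (h : IsovariantlyHomotopic G q f₀ f₁) : Continuous f₀ := by
  obtain ⟨H, -, hi, rfl, -⟩ := h
  exact (hi 0).1

lemma _root_.IsovariantlyHomotopic.continuous_right {f₀ f₁ : X → C(unitInterval, Y)}
    (h : IsovariantlyHomotopic G q f₀ f₁) : Continuous f₁ := by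
  obtain ⟨H, -, hi, -, rfl⟩ := h
  exact (hi 1).1

lemma _root_.IsovariantlyHomotopic.symm {f₀ f₁ : X → C(unitInterval, Y)}
    (h : IsovariantlyHomotopic G q f₀ f₁) : IsovariantlyHomotopic G q f₁ f₀ :=
  (isovariantlyHomotopic_iff ⟨f₁, h.continuous_right⟩ ⟨f₀, h.continuous_left⟩).2
    ((isovariantlyHomotopic_iff ⟨f₀, h.continuous_left⟩ ⟨f₁, h.continuous_right⟩).1 h).symm

lemma _root_.IsovariantlyHomotopic.trans {f₀ f₁ f₂ : X → C(unitInterval, Y)}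
    (h : IsovariantlyHomotopic G q f₀ f₁) (h' : IsovariantlyHomotopic G q f₁ f₂) :
    IsovariantlyHomotopic G q f₀ f₂ :=
  (isovariantlyHomotopic_iff ⟨f₀, h.continuous_left⟩ ⟨f₂, h'.continuous_right⟩).2
    (((isovariantlyHomotopic_iff ⟨f₀, h.continuous_left⟩ ⟨f₁, h.continuous_right⟩).1 h).trans
      ((isovariantlyHomotopic_iff ⟨f₁, h.continuous_right⟩ ⟨f₂, h'.continuous_right⟩).1 h'))

lemma _root_.IsovariantlyHomotopic.restrict {f₀ f₁ : X → C(unitInterval, Y)}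
    (h : IsovariantlyHomotopic G q f₀ f₁) :
    EquivariantlyHomotopic G q (fun x => f₀ x.1) (fun x => f₁ x.1) := by
  obtain ⟨H, hc, hi, rfl, rfl⟩ := h
  exact ⟨fun s x => H s x.1,
    hc.comp (f := fun p : unitInterval × {x : X // x ∉ fixedPoints G X} => (p.1, p.2.1))
      (by fun_prop), fun s => IsIsovariantMap.restrict (hi s), rfl, rfl⟩

end HomotopyLink

/-- **Isovariant versus equivariant maps into the homotopy tangent space.**
Let a finite group `G` act semifreely by isometries on metric spaces `X` and
`Y`, and let `q ∈ Y` be a fixed point isolated in `Y^G`.  Then restriction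
`f ↦ f|_{X - X^G}` induces a well-defined bijection from the set of isovariant
homotopy classes of isovariant maps `X → t_qY` to the set of `G`-homotopy
classes of `G`-equivariant maps `X - X^G → t^qY`: two isovariant maps are
isovariantly homotopic iff their restrictions are `G`-homotopic, and every
equivariant map `X - X^G → t^qY` is `G`-homotopic to the restriction of an
isovariant map. -/
theorem isovariant_vs_equivariant (G X Y : Type) [Group G] [Finite G]
    [MetricSpace X] [MetricSpace Y] [MulAction G X] [MulAction G Y]
    (hXiso : ∀ g : G, Isometry (fun x : X => g • x))
    (hYiso : ∀ g : G, Isometry (fun y : Y => g • y))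
    (hXsemi : ∀ x : X, x ∈ MulAction.fixedPoints G X ∨ ∀ g : G, g • x = x → g = 1)
    (hYsemi : ∀ y : Y, y ∈ MulAction.fixedPoints G Y ∨ ∀ g : G, g • y = y → g = 1)
    (q : Y) (hq : q ∈ MulAction.fixedPoints G Y)
    (hqiso : ∃ U : Set Y, IsOpen U ∧ U ∩ MulAction.fixedPoints G Y = {q}) :
    ((∀ f₀ f₁ : X → C(unitInterval, Y),
      IsIsovariantMap G q f₀ → IsIsovariantMap G q f₁ →
        (IsovariantlyHomotopic G q f₀ f₁ ↔
          EquivariantlyHomotopic G q (fun x => f₀ x.1) (fun x => f₁ x.1))) ∧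
     (∀ F : {x : X // x ∉ MulAction.fixedPoints G X} → C(unitInterval, Y),
      IsEquivariantMap G q F →
        ∃ f : X → C(unitInterval, Y), IsIsovariantMap G q f ∧
          EquivariantlyHomotopic G q (fun x => f x.1) F)) := by
  obtain ⟨δ, hδ, hδ1, hδ0, hδpos, hδinv⟩ := HomotopyLink.exists_invariant_gauge hXiso
  refine ⟨fun f₀ f₁ hf₀ hf₁ => ⟨fun h => h.restrict, ?_⟩, fun F hF => ?_⟩
  · rintro ⟨F, hF, hFeq, h0, h1⟩
    obtain ⟨c, hc, hpos, hinv, hle⟩ :=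
      HomotopyLink.exists_scale hYiso hq hF hFeq hδ hδ1 hδpos hδinv
    have hmid := HomotopyLink.isovariantlyHomotopic_extendConst hXiso hq
      (F := fun s x => HomotopyLink.scalePath (F s x) (c x))
      (HomotopyLink.continuous_scalePath hF (by fun_prop))
      (fun s => (hFeq s).scalePath hc hpos hinv) hδ hδ0 hle
    simp only [h0, h1] at hmid
    exact ((hf₀.homotopic_scalePath hXiso hq hc hpos hinv).trans hmid).trans
      (hf₁.homotopic_scalePath hXiso hq hc hpos hinv).symm
  · have hFc := hF.1
    obtain ⟨c, hc, hpos, hinv, hle⟩ :=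
      HomotopyLink.exists_scale hYiso hq (F := fun _ => F) (by fun_prop) (fun _ => hF)
        hδ hδ1 hδpos hδinv
    have hcont := HomotopyLink.continuous_extendConst hXiso
      (F := fun _ x => HomotopyLink.scalePath (F x) (c x))
      (HomotopyLink.continuous_scalePath (by fun_prop) (by fun_prop)) hδ hδ0 hle
    refine ⟨_, HomotopyLink.isIsovariantMap_extendConst hq (hF.scalePath hc hpos hinv)
      (hcont.comp (by fun_prop : Continuous fun x : X => ((0 : unitInterval), x))), ?_⟩
    simpa only [HomotopyLink.extendConst_coe] using hF.homotopic_scalePath hc hpos hinv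
end
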